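/- (Quadratic recursion.) Let x_1,...,x_n be i.i.d. real random variables with E[x_i] = 0, E[x_i²] = 1 and |x_i| ≤ L almost surely. Let {A_{i,j}}_{(i,j) ∈ T²_n} be deterministic real matrices of a common dimension satisfying A_{i,j} = A_{j,i} for all (i,j) ∈ T²_n, and define F(x) = Σ_{(i,j) ∈ T²_n} A_{i,j} x_i x_j. Then for every 2 ≤ t < ∞, E ‖F(x) − E F(x)‖_{4t} ≤ 2 (32t)² · Σ_{a+b+c=2, a,b,c ≥ 0} L^c · ‖F_{a,b,c}‖_{4t}. -/

import Mathlib

open MeasureTheory ProbabilityTheory Matrix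
open scoped BigOperators ENNReal

/-- Entrywise expectation of a random matrix. -/
noncomputable def matIntegral {Ω : Type*} [MeasurableSpace Ω] (μ : Measure Ω)
    {R C : Type*} (M : Ω → Matrix R C ℝ) : Matrix R C ℝ :=
  Matrix.of fun i j => ∫ ω, M ω i j ∂μ

/-- `schattenPow t A = tr ((AᴴA)^t) = ‖A‖_{2t}^{2t}`, the `2t`-th power of the Schatten
`2t`-norm of a real matrix `A`, defined for a real exponent `t` via the eigenvalues of
the Hermitian matrix `AᴴA`. -/
noncomputable def schattenPow {R C : Type*} [Fintype R] [Fintype C] [DecidableEq C]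
    (t : ℝ) (A : Matrix R C ℝ) : ℝ :=
  ∑ i, (Matrix.isHermitian_conjTranspose_mul_self A).eigenvalues i ^ t

/-- The Schatten `2t`-norm of a real matrix: `‖A‖_{2t} = (tr ((AᴴA)^t))^(1/(2t))`. -/
noncomputable def schattenNorm {R C : Type*} [Fintype R] [Fintype C] [DecidableEq C]
    (t : ℝ) (A : Matrix R C ℝ) : ℝ :=
  schattenPow t A ^ (2 * t)⁻¹
/-- Entrywise partial derivative of a matrix-valued function with respect to the
coordinate `v`. -/
noncomputable def pderivAt {ι : Type*} [Fintype ι] [DecidableEq ι] {R C : Type*}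
    (F : (ι → ℝ) → Matrix R C ℝ) (v : ι) : (ι → ℝ) → Matrix R C ℝ :=
  fun x => Matrix.of fun r c => fderiv ℝ (fun y => F y r c) x (Pi.single v 1)

/-- Iterated entrywise partial derivative along a tuple of coordinates. -/
noncomputable def iterPDeriv {ι : Type*} [Fintype ι] [DecidableEq ι] {R C : Type*}
    (F : (ι → ℝ) → Matrix R C ℝ) : {k : ℕ} → (Fin k → ι) → (ι → ℝ) → Matrix R C ℝ
  | 0, _ => F
  | _ + 1, w => pderivAt (iterPDeriv F fun j => w j.castSucc) (w (Fin.last _))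

/-- The partial-derivative block matrix `F_{a,b,c}`: rows carry the `a` vertically stacked
derivative directions, columns the `b` horizontally placed ones, and the `c` block-diagonal
directions appear in both (with the diagonal constraint). -/
noncomputable def derivBlocks {n : ℕ} {R C : Type*}
    (F : (Fin n → ℝ) → Matrix R C ℝ) (a b c : ℕ) :
    (Fin n → ℝ) →
      Matrix ((Fin a → Fin n) × (Fin c → Fin n) × R) ((Fin b → Fin n) × (Fin c → Fin n) × C) ℝ :=
  fun x => Matrix.of fun p q =>
    if p.2.1 = q.2.1 then
      iterPDeriv F (Fin.append (Fin.append p.1 q.1) p.2.1) x p.2.2 q.2.2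
    else 0

/-- The partial-derivative block matrix `F_{a,b}` (no diagonal blocks): rows carry the `a`
vertically stacked derivative directions and columns the `b` horizontally placed ones. -/
noncomputable def derivBlocks2 {ι : Type*} [Fintype ι] [DecidableEq ι] {R C : Type*}
    (F : (ι → ℝ) → Matrix R C ℝ) (a b : ℕ) :
    (ι → ℝ) → Matrix ((Fin a → ι) × R) ((Fin b → ι) × C) ℝ :=
  fun x => Matrix.of fun p q => iterPDeriv F (Fin.append p.1 q.1) x p.2 q.2


open MeasureTheory ProbabilityTheory Matrix
open scoped BigOperators ENNReal
namespace QR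

variable {ι : Type*} [Fintype ι] [DecidableEq ι]

/-- Function of a symmetric matrix. -/
noncomputable def fm (f : ℝ → ℝ) (A : Matrix ι ι ℝ) : Matrix ι ι ℝ :=
  open Classical in
  if h : A.IsHermitian then
    (h.eigenvectorUnitary : Matrix ι ι ℝ) * diagonal (fun i => f (h.eigenvalues i)) *
      (h.eigenvectorUnitary : Matrix ι ι ℝ)ᵀ
  else 0

lemma U_mul (A : Matrix ι ι ℝ) (h : A.IsHermitian) :
    (h.eigenvectorUnitary : Matrix ι ι ℝ)ᵀ * (h.eigenvectorUnitary : Matrix ι ι ℝ) = 1 := by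
  have := (Matrix.mem_unitaryGroup_iff').1 h.eigenvectorUnitary.2
  simpa [star_eq_conjTranspose] using this

lemma U_mul' (A : Matrix ι ι ℝ) (h : A.IsHermitian) :
    (h.eigenvectorUnitary : Matrix ι ι ℝ) * (h.eigenvectorUnitary : Matrix ι ι ℝ)ᵀ = 1 := by
  have := (Matrix.mem_unitaryGroup_iff).1 h.eigenvectorUnitary.2
  simpa [star_eq_conjTranspose] using this

lemma fm_id {A : Matrix ι ι ℝ} (h : A.IsHermitian) : fm (fun u => u) A = A := by
  have := h.spectral_theorem
  rw [fm, dif_pos h]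
  conv_rhs => rw [this]
  simp [Unitary.conjStarAlgAut_apply, star_eq_conjTranspose]

lemma fm_one {A : Matrix ι ι ℝ} (h : A.IsHermitian) : fm (fun _ => 1) A = 1 := by
  rw [fm, dif_pos h]
  simp [U_mul']

lemma fm_mul {A : Matrix ι ι ℝ} (h : A.IsHermitian) (f g : ℝ → ℝ) :
    fm f A * fm g A = fm (fun u => f u * g u) A := by
  rw [fm, fm, fm, dif_pos h, dif_pos h, dif_pos h]
  rw [← diagonal_mul_diagonal]
  simp only [Matrix.mul_assoc]
  rw [← Matrix.mul_assoc (_)ᵀ (h.eigenvectorUnitary : Matrix ι ι ℝ), U_mul, Matrix.one_mul]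

lemma fm_isHermitian (f : ℝ → ℝ) (A : Matrix ι ι ℝ) : (fm f A).IsHermitian := by
  by_cases h : A.IsHermitian
  · rw [fm, dif_pos h, IsHermitian]
    simp [Matrix.mul_assoc]
  · rw [fm, dif_neg h]; simp

lemma fm_smul (c : ℝ) (f : ℝ → ℝ) (A : Matrix ι ι ℝ) : fm (fun u => c * f u) A = c • fm f A := by
  by_cases h : A.IsHermitian
  · rw [fm, fm, dif_pos h, dif_pos h]
    have : diagonal (fun i => c * f (h.eigenvalues i)) = c • diagonal (fun i => f (h.eigenvalues i)) := by
      ext i j; simp [diagonal_apply]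
    rw [this]; simp
  · rw [fm, fm, dif_neg h, dif_neg h]; simp

lemma tr_fm {A : Matrix ι ι ℝ} (h : A.IsHermitian) (f : ℝ → ℝ) :
    (fm f A).trace = ∑ i, f (h.eigenvalues i) := by
  rw [fm, dif_pos h, Matrix.trace_mul_cycle, U_mul, Matrix.one_mul, trace_diagonal]

lemma tr_fm_roots {A : Matrix ι ι ℝ} (h : A.IsHermitian) (f : ℝ → ℝ) :
    (fm f A).trace = (A.charpoly.roots.map f).sum := by
  rw [tr_fm h, h.roots_charpoly_eq_eigenvalues]
  simp

/-- overlap weights -/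
noncomputable def wt {A B : Matrix ι ι ℝ} (hA : A.IsHermitian) (hB : B.IsHermitian) (j k : ι) : ℝ :=
  (((hA.eigenvectorUnitary : Matrix ι ι ℝ)ᵀ * (hB.eigenvectorUnitary : Matrix ι ι ℝ)) j k) ^ 2

lemma wt_nonneg {A B : Matrix ι ι ℝ} (hA : A.IsHermitian) (hB : B.IsHermitian) (j k : ι) :
    0 ≤ wt hA hB j k := sq_nonneg _

lemma tr_fm_mul {A B : Matrix ι ι ℝ} (hA : A.IsHermitian) (hB : B.IsHermitian) (f g : ℝ → ℝ) :
    (fm f A * fm g B).trace =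
      ∑ j, ∑ k, wt hA hB j k * (f (hA.eigenvalues j) * g (hB.eigenvalues k)) := by
  rw [fm, fm, dif_pos hA, dif_pos hB]
  set U := (hA.eigenvectorUnitary : Matrix ι ι ℝ) with hU
  set V := (hB.eigenvectorUnitary : Matrix ι ι ℝ) with hV
  set D := diagonal (fun i => f (hA.eigenvalues i))
  set E := diagonal (fun i => g (hB.eigenvalues i))
  have : (U * D * Uᵀ * (V * E * Vᵀ)).trace = (D * (Uᵀ * V) * (E * (Uᵀ * V)ᵀ)).trace := by
    rw [Matrix.transpose_mul, Matrix.transpose_transpose]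
    rw [show U * D * Uᵀ * (V * E * Vᵀ) = U * (D * Uᵀ * (V * E * Vᵀ)) by simp only [Matrix.mul_assoc],
      Matrix.trace_mul_comm]
    simp only [Matrix.mul_assoc]
  rw [this]
  simp only [Matrix.trace, Matrix.diag_apply, Matrix.mul_apply (M := D * (Uᵀ * V)), wt]
  refine Finset.sum_congr rfl fun j _ => Finset.sum_congr rfl fun k _ => ?_
  simp only [D, E, Matrix.diagonal_mul, Matrix.transpose_apply]
  ring

lemma tr_fm_left {A B : Matrix ι ι ℝ} (hA : A.IsHermitian) (hB : B.IsHermitian) (f : ℝ → ℝ) :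
    (fm f A).trace = ∑ j, ∑ k, wt hA hB j k * f (hA.eigenvalues j) := by
  have := tr_fm_mul hA hB f (fun _ => 1)
  simpa [fm_one hB] using this

lemma tr_fm_right {A B : Matrix ι ι ℝ} (hA : A.IsHermitian) (hB : B.IsHermitian) (g : ℝ → ℝ) :
    (fm g B).trace = ∑ j, ∑ k, wt hA hB j k * g (hB.eigenvalues k) := by
  have := tr_fm_mul hA hB (fun _ => 1) g
  simpa [fm_one hA] using this

lemma tr_left_mul {A B : Matrix ι ι ℝ} (hA : A.IsHermitian) (hB : B.IsHermitian) (g : ℝ → ℝ) :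
    (A * fm g B).trace =
      ∑ j, ∑ k, wt hA hB j k * (hA.eigenvalues j * g (hB.eigenvalues k)) := by
  have := tr_fm_mul hA hB (fun u => u) g
  rwa [fm_id hA] at this

lemma tr_sq_left_mul {A B : Matrix ι ι ℝ} (hA : A.IsHermitian) (hB : B.IsHermitian) (g : ℝ → ℝ) :
    (A * A * fm g B).trace =
      ∑ j, ∑ k, wt hA hB j k * ((hA.eigenvalues j * hA.eigenvalues j) * g (hB.eigenvalues k)) := by
  have := tr_fm_mul hA hB (fun u => u * u) g
  rwa [← fm_mul hA, fm_id hA] at this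

/-- `tr (A-B)(g A - g B)` -/
lemma tr_diff {A B : Matrix ι ι ℝ} (hA : A.IsHermitian) (hB : B.IsHermitian) (f g : ℝ → ℝ) :
    ((fm f A - fm f B) * (fm g A - fm g B)).trace =
      ∑ j, ∑ k, wt hA hB j k * ((f (hA.eigenvalues j) - f (hB.eigenvalues k)) *
        (g (hA.eigenvalues j) - g (hB.eigenvalues k))) := by
  have e : ((fm f A - fm f B) * (fm g A - fm g B)).trace =
     (fm (fun u => f u * g u) A).trace - (fm f A * fm g B).trace - (fm g A * fm f B).trace
       + (fm (fun u => f u * g u) B).trace := by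
    rw [← fm_mul hA, ← fm_mul hB, Matrix.sub_mul, Matrix.mul_sub, Matrix.mul_sub]
    simp only [Matrix.trace_sub]
    rw [Matrix.trace_mul_comm (fm f B) (fm g A)]
    ring
  rw [e, tr_fm_left hA hB, tr_fm_right hA hB, tr_fm_mul hA hB, tr_fm_mul hA hB]
  simp only [← Finset.sum_sub_distrib, ← Finset.sum_add_distrib]
  refine Finset.sum_congr rfl fun j _ => Finset.sum_congr rfl fun k _ => ?_
  ring

lemma tr_sq_diff_left {A B : Matrix ι ι ℝ} (hA : A.IsHermitian) (hB : B.IsHermitian) (h : ℝ → ℝ) :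
    ((A - B) * (A - B) * fm h A).trace =
      ∑ j, ∑ k, wt hA hB j k * ((hA.eigenvalues j - hB.eigenvalues k) ^ 2 * h (hA.eigenvalues j)) := by
  have e : ((A - B) * (A - B) * fm h A).trace =
     (fm (fun u => u * u * h u) A).trace - 2 * (fm (fun u => u * h u) A * fm (fun u => u) B).trace
       + (fm h A * fm (fun u => u * u) B).trace := by
    rw [← fm_mul hB, ← fm_mul hA (fun u => u), ← fm_mul hA (fun u => u * u),
      ← fm_mul hA (fun u => u), fm_id hA, fm_id hB]
    rw [show (A - B) * (A - B) * fm h A = A * A * fm h A - A * (B * fm h A) - B * (A * fm h A) 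
      + (B * B) * fm h A by noncomm_ring]
    rw [Matrix.trace_add, Matrix.trace_sub, Matrix.trace_sub, Matrix.trace_mul_comm (B * B),
      Matrix.trace_mul_comm B, Matrix.trace_mul_comm A (B * fm h A)]
    have h1 : A * fm h A = fm h A * A := by
      conv_lhs => rw [← fm_id hA]
      conv_rhs => rw [← fm_id hA]
      rw [fm_id hA, ← fm_id hA, fm_id hA]
      have a := fm_mul hA (fun u => u) h
      have b := fm_mul hA h (fun u => u)
      rw [fm_id hA] at a b
      rw [a, b]; congr 1; ext u; ring
    rw [show B * fm h A * A = B * (A * fm h A) by rw [h1, Matrix.mul_assoc], Matrix.trace_mul_comm B]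
    ring
  rw [e, tr_fm_left hA hB, tr_fm_mul hA hB, tr_fm_mul hA hB]
  simp only [Finset.mul_sum, ← Finset.sum_sub_distrib, ← Finset.sum_add_distrib]
  refine Finset.sum_congr rfl fun j _ => Finset.sum_congr rfl fun k _ => ?_
  ring

lemma wt_swap {A B : Matrix ι ι ℝ} (hA : A.IsHermitian) (hB : B.IsHermitian) (j k : ι) :
    wt hB hA k j = wt hA hB j k := by
  unfold wt
  congr 1
  rw [← Matrix.transpose_apply (_ * _), Matrix.transpose_mul, Matrix.transpose_transpose]

lemma tr_sq_diff_right {A B : Matrix ι ι ℝ} (hA : A.IsHermitian) (hB : B.IsHermitian) (h : ℝ → ℝ) :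
    ((A - B) * (A - B) * fm h B).trace =
      ∑ j, ∑ k, wt hA hB j k * ((hA.eigenvalues j - hB.eigenvalues k) ^ 2 * h (hB.eigenvalues k)) := by
  rw [show (A - B) * (A - B) = (B - A) * (B - A) by noncomm_ring, tr_sq_diff_left hB hA,
    Finset.sum_comm]
  refine Finset.sum_congr rfl fun j _ => Finset.sum_congr rfl fun k _ => ?_
  rw [wt_swap]; ring

/-- mean value trace inequality -/
lemma mean_value_trace {A B : Matrix ι ι ℝ} (hA : A.IsHermitian) (hB : B.IsHermitian)
    (g h : ℝ → ℝ) (hgh : ∀ a b, (a - b) * (g a - g b) ≤ (a - b) ^ 2 * h a + (a - b) ^ 2 * h b) :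
    ((A - B) * (fm g A - fm g B)).trace ≤
      ((A - B) * (A - B) * fm h A).trace + ((A - B) * (A - B) * fm h B).trace := by
  have e := tr_diff hA hB (fun u => u) g
  rw [fm_id hA, fm_id hB] at e
  rw [e, tr_sq_diff_left hA hB, tr_sq_diff_right hA hB, ← Finset.sum_add_distrib]
  refine Finset.sum_le_sum fun j _ => ?_
  rw [← Finset.sum_add_distrib]
  refine Finset.sum_le_sum fun k _ => ?_
  rw [← mul_add]
  exact mul_le_mul_of_nonneg_left (hgh _ _) (wt_nonneg _ _ _ _)

/-- functional calculus of composition at trace level -/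
lemma tr_fm_comp {A : Matrix ι ι ℝ} (hA : A.IsHermitian) (φ f : ℝ → ℝ) :
    (fm f (fm φ A)).trace = (fm (fun u => f (φ u)) A).trace := by
  have hB := fm_isHermitian φ A
  have e : ∑ j, ∑ k, wt hA hB j k * ((φ (hA.eigenvalues j) - hB.eigenvalues k) ^ 2) = 0 := by
    have h0 : (fm (fun u => φ u * φ u) A).trace - 2 * (fm φ A * fm (fun u => u) (fm φ A)).trace
       + (fm (fun u => u * u) (fm φ A)).trace = 0 := by
      rw [← fm_mul hB, fm_id hB, ← fm_mul hA]; ring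
    rw [← h0, tr_fm_left hA hB, tr_fm_mul hA hB, tr_fm_right hA hB]
    simp only [Finset.mul_sum, ← Finset.sum_sub_distrib, ← Finset.sum_add_distrib]
    refine Finset.sum_congr rfl fun j _ => Finset.sum_congr rfl fun k _ => ?_
    ring
  rw [tr_fm_left hA hB, tr_fm_right hA hB]
  refine Finset.sum_congr rfl fun j _ => Finset.sum_congr rfl fun k _ => ?_
  have hnn : ∀ j k, 0 ≤ wt hA hB j k * ((φ (hA.eigenvalues j) - hB.eigenvalues k) ^ 2) := 
    fun j k => mul_nonneg (wt_nonneg _ _ _ _) (sq_nonneg _)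
  rw [Finset.sum_eq_zero_iff_of_nonneg (fun j _ => Finset.sum_nonneg fun k _ => hnn j k)] at e
  have e2 := e j (Finset.mem_univ _)
  rw [Finset.sum_eq_zero_iff_of_nonneg (fun k _ => hnn j k)] at e2
  have e3 := e2 k (Finset.mem_univ _)
  rcases mul_eq_zero.1 e3 with h | h
  · rw [h]; simp
  · have : φ (hA.eigenvalues j) = hB.eigenvalues k := by
      have := pow_eq_zero_iff (two_ne_zero) |>.1 h
      linarith
    rw [this]

lemma fm_congr {A : Matrix ι ι ℝ} (f g : ℝ → ℝ) 
    (h : ∀ hA : A.IsHermitian, ∀ i, f (hA.eigenvalues i) = g (hA.eigenvalues i)) : fm f A = fm g A := by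
  unfold fm
  split_ifs with hA
  · simp only [h hA]
  · rfl

end QR

open MeasureTheory ProbabilityTheory Matrix
open scoped BigOperators ENNReal
namespace QR

variable {ι : Type*} [Fintype ι] [DecidableEq ι]

/-- absolute power -/
noncomputable def pw (s : ℝ) (u : ℝ) : ℝ := |u| ^ s
/-- signed power -/
noncomputable def sg (p : ℝ) (u : ℝ) : ℝ := u * |u| ^ (p - 2)

lemma pw_nonneg (s u : ℝ) : 0 ≤ pw s u := Real.rpow_nonneg (abs_nonneg _) _

lemma continuous_pw {s : ℝ} (hs : 0 ≤ s) : Continuous (pw s) :=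
  continuous_abs.rpow_const fun _ => Or.inr hs

lemma hasDerivAt_pw {s : ℝ} (hs : 1 < s) (u : ℝ) : HasDerivAt (pw s) (s * |u| ^ (s - 2) * u) u :=
  hasDerivAt_abs_rpow u hs

lemma hasDerivAt_sg {p : ℝ} (hp : 3 < p) (u : ℝ) : HasDerivAt (sg p) ((p - 1) * |u| ^ (p - 2)) u := by
  have : HasDerivAt (sg p) (1 * pw (p - 2) u + u * ((p - 2) * |u| ^ (p - 2 - 2) * u)) u :=
    (hasDerivAt_id u).mul (hasDerivAt_pw (s := p - 2) (by linarith) u)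
  refine this.congr_deriv ?_
  simp only [pw]
  rcases eq_or_ne u 0 with rfl | hu
  · simp [Real.zero_rpow (show p - 2 ≠ 0 by linarith)]
  · have h0 : 0 < |u| := abs_pos.2 hu
    have : |u| ^ (p - 2) = |u| ^ (p - 2 - 2) * (u * u) := by
      rw [← abs_mul_abs_self u, ← pow_two, ← Real.rpow_natCast, ← Real.rpow_add h0]
      congr 1; push_cast; ring
    rw [this]; ring

/-- locally Lipschitz -/
def LL (f : ℝ → ℝ) : Prop := ∀ r : ℝ, ∃ C : ℝ, ∀ a b : ℝ, |a| ≤ r → |b| ≤ r → |f a - f b| ≤ C * |a - b|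

lemma LL_of_deriv {f f' : ℝ → ℝ} (h : ∀ u, HasDerivAt f (f' u) u) (hc : Continuous f') : LL f := by
  intro r
  obtain ⟨C, hC⟩ := (isCompact_Icc (a := -r) (b := r)).exists_bound_of_continuousOn hc.continuousOn
  refine ⟨C, fun a b ha hb => ?_⟩
  have := (convex_Icc (-r) r).norm_image_sub_le_of_norm_hasDerivWithin_le
    (fun x _ => (h x).hasDerivWithinAt) hC (abs_le.1 hb) (abs_le.1 ha)
  simpa using this

lemma LL_pw {s : ℝ} (hs : 2 ≤ s) : LL (pw s) :=
  LL_of_deriv (hasDerivAt_pw (by linarith))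
    ((continuous_const.mul (continuous_pw (s := s - 2) (by linarith))).mul continuous_id)

lemma LL_sg {p : ℝ} (hp : 3 < p) : LL (sg p) :=
  LL_of_deriv (hasDerivAt_sg hp) (continuous_const.mul (continuous_pw (s := p - 2) (by linarith)))

lemma sg_mvt {p : ℝ} (hp : 3 < p) (a b : ℝ) :
    (a - b) * (sg p a - sg p b) ≤
      (a - b) ^ 2 * ((p - 1) * pw (p - 2) a) + (a - b) ^ 2 * ((p - 1) * pw (p - 2) b) := by
  have key : ∀ a b : ℝ, a < b → (a - b) * (sg p a - sg p b) ≤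
      (a - b) ^ 2 * ((p - 1) * pw (p - 2) a) + (a - b) ^ 2 * ((p - 1) * pw (p - 2) b) := by
    intro a b hab
    obtain ⟨c, hc, e⟩ := exists_hasDerivAt_eq_slope (sg p) _ hab
      (fun x _ => (hasDerivAt_sg hp x).continuousAt.continuousWithinAt)
      (fun x _ => hasDerivAt_sg hp x)
    have hba : 0 < b - a := sub_pos.2 hab
    rw [eq_div_iff hba.ne'] at e
    have : (a - b) * (sg p a - sg p b) = (a - b) ^ 2 * ((p - 1) * |c| ^ (p - 2)) := by
      rw [show sg p a - sg p b = -(sg p b - sg p a) by ring, ← e]; ring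
    rw [this, ← mul_add, ← mul_add]
    refine mul_le_mul_of_nonneg_left (mul_le_mul_of_nonneg_left ?_ (by linarith)) (sq_nonneg _)
    have hm : |c| ≤ max |a| |b| := abs_le_max_abs_abs hc.1.le hc.2.le
    have h2 : 0 ≤ p - 2 := by linarith
    rcases le_max_iff.1 hm with h | h
    · have := Real.rpow_le_rpow (abs_nonneg c) h h2
      have := pw_nonneg (p - 2) b
      unfold pw at *; linarith
    · have := Real.rpow_le_rpow (abs_nonneg c) h h2
      have := pw_nonneg (p - 2) a
      unfold pw at *; linarith
  rcases lt_trichotomy a b with h | h | h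
  · exact key a b h
  · subst h; simp
  · have := key b a h
    nlinarith [this]

lemma mul_sg {p : ℝ} (hp : 2 < p) (u : ℝ) : u * sg p u = pw p u := by
  unfold sg pw
  rcases eq_or_ne u 0 with rfl | hu
  · simp [Real.zero_rpow (show p ≠ 0 by linarith)]
  · have h0 : 0 < |u| := abs_pos.2 hu
    rw [← mul_assoc, ← abs_mul_abs_self u, ← pow_two, ← Real.rpow_natCast, ← Real.rpow_add h0]
    congr 1; push_cast; ring

lemma mul_pw_le {s : ℝ} (hs : 0 < s) (u : ℝ) : u * pw s u ≤ pw (s + 1) u := by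
  unfold pw
  rcases eq_or_ne u 0 with rfl | hu
  · simp [Real.zero_rpow (show s + 1 ≠ 0 by linarith)]
  · have h0 : 0 < |u| := abs_pos.2 hu
    rw [Real.rpow_add h0, Real.rpow_one, mul_comm]
    exact mul_le_mul_of_nonneg_left (le_abs_self u) (Real.rpow_nonneg h0.le _)

lemma abs_sg {p : ℝ} (hp : 2 < p) (u : ℝ) : |sg p u| = pw (p - 1) u := by
  unfold sg pw
  rcases eq_or_ne u 0 with rfl | hu
  · simp [Real.zero_rpow (show p - 1 ≠ 0 by linarith)]
  · have h0 : 0 < |u| := abs_pos.2 hu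
    rw [abs_mul, abs_of_nonneg (Real.rpow_nonneg h0.le _), ← Real.rpow_one_add' h0.le (by linarith)]
    congr 1; ring

lemma sg_le {p : ℝ} (hp : 2 < p) (u : ℝ) : sg p u ≤ pw (p - 1) u := by
  rw [← abs_sg hp]; exact le_abs_self _

/-- continuity of functional calculus -/
lemma continuous_fm {E : Type*} [TopologicalSpace E] {M : E → Matrix ι ι ℝ} (hM : Continuous M)
    (hH : ∀ x, (M x).IsHermitian) {f : ℝ → ℝ} (hf : LL f) : Continuous fun x => fm f (M x) := by
  have hq : ∀ A : Matrix ι ι ℝ, A.IsHermitian → ∀ i j, (A i j) ^ 2 ≤ (A * A).trace := by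
    intro A hA i j
    have : (A * A).trace = ∑ i, ∑ j, (A i j) ^ 2 := by
      simp only [Matrix.trace, Matrix.diag_apply, Matrix.mul_apply]
      refine Finset.sum_congr rfl fun i _ => Finset.sum_congr rfl fun j _ => ?_
      have := hA.apply i j
      simp at this
      rw [pow_two, this]
    rw [this]
    exact (Finset.single_le_sum (f := fun j => (A i j) ^ 2) (fun j _ => sq_nonneg _) (Finset.mem_univ j)).trans
      (Finset.single_le_sum (f := fun i => ∑ j, (A i j) ^ 2)
        (fun i _ => Finset.sum_nonneg fun j _ => sq_nonneg _) (Finset.mem_univ i))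
  have heig : ∀ A : Matrix ι ι ℝ, ∀ hA : A.IsHermitian, ∀ i, (hA.eigenvalues i) ^ 2 ≤ (A * A).trace := by
    intro A hA i
    have e := tr_fm hA (fun u => u * u)
    rw [← fm_mul hA, fm_id hA] at e
    rw [e, pow_two]
    exact Finset.single_le_sum (f := fun i => hA.eigenvalues i * hA.eigenvalues i)
      (fun j _ => mul_self_nonneg _) (Finset.mem_univ i)
  rw [continuous_iff_continuousAt]
  intro x0
  set r : ℝ := Real.sqrt ((M x0 * M x0).trace + 1)
  obtain ⟨C, hC⟩ := hf r
  have htr : Continuous fun x => (M x * M x).trace := (hM.matrix_mul hM).matrix_trace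
  have hev : ∀ᶠ x in nhds x0, (M x * M x).trace < (M x0 * M x0).trace + 1 :=
    (htr.tendsto x0).eventually_lt_const (by linarith)
  have hbound : ∀ᶠ x in nhds x0, ((fm f (M x) - fm f (M x0)) * (fm f (M x) - fm f (M x0))).trace
      ≤ C ^ 2 * ((M x - M x0) * (M x - M x0)).trace := by
    filter_upwards [hev] with x hx
    have e := tr_diff (hH x) (hH x0) (fun u => u) (fun u => u)
    rw [fm_id (hH x), fm_id (hH x0)] at e
    rw [tr_diff (hH x) (hH x0), e, Finset.mul_sum]
    refine Finset.sum_le_sum fun j _ => ?_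
    rw [Finset.mul_sum]
    refine Finset.sum_le_sum fun k _ => ?_
    have := hC ((hH x).eigenvalues j) ((hH x0).eigenvalues k)
      (Real.abs_le_sqrt ((heig _ _ _).trans hx.le)) (Real.abs_le_sqrt ((heig _ _ _).trans (by linarith)))
    have h2 := mul_self_le_mul_self (abs_nonneg _) this
    rw [abs_mul_abs_self] at h2
    have h3 : C * |(hH x).eigenvalues j - (hH x0).eigenvalues k| * (C * |(hH x).eigenvalues j - (hH x0).eigenvalues k|)
      = C ^ 2 * (((hH x).eigenvalues j - (hH x0).eigenvalues k) * ((hH x).eigenvalues j - (hH x0).eigenvalues k)) := by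
      rw [← abs_mul_abs_self ((hH x).eigenvalues j - (hH x0).eigenvalues k)]; ring
    rw [h3] at h2
    calc _ ≤ wt (hH x) (hH x0) j k * _ := mul_le_mul_of_nonneg_left h2 (wt_nonneg _ _ _ _)
      _ = _ := by ring
  have hlim : Filter.Tendsto (fun x => C ^ 2 * ((M x - M x0) * (M x - M x0)).trace) (nhds x0) (nhds 0) := by
    have hc : Continuous fun x => C ^ 2 * ((M x - M x0) * (M x - M x0)).trace :=
      continuous_const.mul (((hM.sub continuous_const).matrix_mul (hM.sub continuous_const)).matrix_trace)
    have := hc.tendsto x0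
    simpa using this
  refine tendsto_pi_nhds.2 fun i => tendsto_pi_nhds.2 fun j => ?_
  rw [tendsto_iff_norm_sub_tendsto_zero]
  have hs := (Real.continuous_sqrt.tendsto 0).comp hlim
  rw [Real.sqrt_zero] at hs
  refine squeeze_zero' (Filter.Eventually.of_forall fun _ => norm_nonneg _) ?_ hs
  filter_upwards [hbound] with x hx
  refine Real.abs_le_sqrt ((?_ : _ ≤ _).trans hx)
  exact hq _ ((fm_isHermitian _ _).sub (fm_isHermitian _ _)) i j

end QR

open MeasureTheory ProbabilityTheory Matrix
open scoped BigOperators ENNReal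
namespace QR

section meas
variable {J : Type*} [Fintype J] [DecidableEq J]

/-- standing assumptions on the marginal laws -/
structure Good (ν : J → Measure ℝ) (L : ℝ) : Prop where
  prob : ∀ i, IsProbabilityMeasure (ν i)
  mean : ∀ i, ∫ u, u ∂(ν i) = 0
  var : ∀ i, ∫ u, u ^ 2 ∂(ν i) = 1
  bdd : ∀ i, ∀ᵐ u ∂(ν i), |u| ≤ L
  one_le : 1 ≤ L

/-- swap the coordinates in `S` -/
def sw (S : Finset J) (z : (J → ℝ) × (J → ℝ)) : (J → ℝ) × (J → ℝ) :=
  (fun i => if i ∈ S then z.2 i else z.1 i, fun i => if i ∈ S then z.1 i else z.2 i)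

@[fun_prop]
lemma continuous_sw (S : Finset J) : Continuous (sw S) := by
  unfold sw
  refine Continuous.prodMk (continuous_pi fun i => ?_) (continuous_pi fun i => ?_) <;>
  · split_ifs <;> fun_prop

variable {ν : J → Measure ℝ} {L : ℝ}

lemma sw_mp [∀ i, IsProbabilityMeasure (ν i)] (S : Finset J) :
    MeasurePreserving (sw S) ((Measure.pi ν).prod (Measure.pi ν)) ((Measure.pi ν).prod (Measure.pi ν)) := by
  have h1 := measurePreserving_arrowProdEquivProdArrow ℝ ℝ J ν ν
  have h2 : MeasurePreserving (fun (a : J → ℝ × ℝ) i => (if i ∈ S then Prod.swap else id) (a i))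
      (Measure.pi fun i => (ν i).prod (ν i)) (Measure.pi fun i => (ν i).prod (ν i)) := by
    refine measurePreserving_pi _ _ (f := fun i => if i ∈ S then Prod.swap else id) fun i => ?_
    by_cases h : i ∈ S
    · simp only [h, if_true]; exact Measure.measurePreserving_swap
    · simp only [h, if_false]; exact MeasurePreserving.id _
  have h3 := (h1.comp h2).comp (h1.symm _)
  convert h3 using 1
  ext z i
  · by_cases h : i ∈ S <;> simp [sw, h, MeasurableEquiv.arrowProdEquivProdArrow, Equiv.arrowProdEquivProdArrow]
  · by_cases h : i ∈ S <;> simp [sw, h, MeasurableEquiv.arrowProdEquivProdArrow, Equiv.arrowProdEquivProdArrow]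

lemma int_sw [∀ i, IsProbabilityMeasure (ν i)] (S : Finset J) {Φ : (J → ℝ) × (J → ℝ) → ℝ} (hΦ : Continuous Φ) :
    ∫ z, Φ (sw S z) ∂((Measure.pi ν).prod (Measure.pi ν)) = ∫ z, Φ z ∂((Measure.pi ν).prod (Measure.pi ν)) := by
  have := (sw_mp (ν := ν) S)
  conv_rhs => rw [← this.map_eq]
  rw [integral_map this.measurable.aemeasurable]
  exact hΦ.aestronglyMeasurable

lemma Good.ae (h : Good ν L) : ∀ᵐ x ∂(Measure.pi ν), ∀ i, |x i| ≤ L := by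
  haveI := h.prob
  rw [ae_all_iff]
  intro i
  exact (measurePreserving_eval ν i).quasiMeasurePreserving.ae (h.bdd i)

lemma Good.ae2 (h : Good ν L) : ∀ᵐ z ∂((Measure.pi ν).prod (Measure.pi ν)),
    (∀ i, |z.1 i| ≤ L) ∧ ∀ i, |z.2 i| ≤ L := by
  haveI := h.prob
  exact (Measure.quasiMeasurePreserving_fst.ae h.ae).and (Measure.quasiMeasurePreserving_snd.ae h.ae)

lemma integrable_of_compact {E : Type*} [TopologicalSpace E] [MeasurableSpace E] [OpensMeasurableSpace E]
    [T2Space E] [SecondCountableTopology E]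
    (m : Measure E) [IsFiniteMeasure m] (K : Set E) (hK : IsCompact K) (h : ∀ᵐ x ∂m, x ∈ K)
    {f : E → ℝ} (hf : Continuous f) : Integrable f m := by
  obtain ⟨C, hC⟩ := hK.exists_bound_of_continuousOn hf.continuousOn
  exact Integrable.of_bound hf.aestronglyMeasurable C (h.mono fun x hx => hC x hx)

lemma compact_box (L : ℝ) : IsCompact {x : J → ℝ | ∀ i, |x i| ≤ L} := by
  have := isCompact_univ_pi (fun _ : J => isCompact_Icc (a := -L) (b := L))
  convert this using 1
  ext x; simp [abs_le, Pi.le_def, forall_and]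

lemma Good.int1 (h : Good ν L) {f : (J → ℝ) → ℝ} (hf : Continuous f) : Integrable f (Measure.pi ν) := by
  haveI := h.prob
  exact integrable_of_compact _ _ (compact_box L) h.ae hf

lemma Good.int2 (h : Good ν L) {f : (J → ℝ) × (J → ℝ) → ℝ} (hf : Continuous f) :
    Integrable f ((Measure.pi ν).prod (Measure.pi ν)) := by
  haveI := h.prob
  refine integrable_of_compact _ _ ((compact_box L).prod (compact_box L)) ?_ hf
  filter_upwards [h.ae2] with z hz
  exact hz

lemma int_eval [∀ i, IsProbabilityMeasure (ν i)] (i : J) {ψ : ℝ → ℝ} (hψ : Continuous ψ) :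
    ∫ x, ψ (x i) ∂(Measure.pi ν) = ∫ u, ψ u ∂(ν i) := by
  have := measurePreserving_eval ν i
  rw [← this.map_eq, integral_map this.measurable.aemeasurable]
  · exact hψ.aestronglyMeasurable

lemma int_snd_fst [∀ i, IsProbabilityMeasure (ν i)] (i : J) {ψ : ℝ → ℝ} (hψ : Continuous ψ) (G : (J → ℝ) → ℝ) :
    ∫ z, ψ (z.2 i) * G z.1 ∂((Measure.pi ν).prod (Measure.pi ν)) = (∫ u, ψ u ∂(ν i)) * ∫ x, G x ∂(Measure.pi ν) := by
  rw [← int_eval (ν := ν) i hψ, mul_comm, ← integral_prod_mul]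
  congr 1; ext z; ring

lemma int_fst [∀ i, IsProbabilityMeasure (ν i)] (G : (J → ℝ) → ℝ) :
    ∫ z, G z.1 ∂((Measure.pi ν).prod (Measure.pi ν)) = ∫ x, G x ∂(Measure.pi ν) := by
  have := integral_prod_mul (μ := Measure.pi ν) (ν := Measure.pi ν) G (fun _ => (1:ℝ))
  simpa using this

end meas

variable {J : Type*} [Fintype J] [DecidableEq J]
variable {ι : Type*} [Fintype ι] [DecidableEq ι] {ν : J → Measure ℝ} {L : ℝ}

/-- random linear combination -/
def lin (ψ : ℝ → ℝ) (C : J → Matrix ι ι ℝ) (x : J → ℝ) : Matrix ι ι ℝ := ∑ i, ψ (x i) • C i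

lemma lin_herm (ψ : ℝ → ℝ) {C : J → Matrix ι ι ℝ} (hC : ∀ i, (C i).IsHermitian) (x : J → ℝ) :
    (lin ψ C x).IsHermitian := by
  unfold lin IsHermitian
  rw [conjTranspose_sum]
  refine Finset.sum_congr rfl fun i _ => ?_
  rw [conjTranspose_smul, (hC i).eq]; simp

lemma continuous_lin {ψ : ℝ → ℝ} (hψ : Continuous ψ) (C : J → Matrix ι ι ℝ) : Continuous (lin ψ C) := by
  unfold lin; fun_prop

attribute [irreducible] sw

lemma lin_sub (ψ : ℝ → ℝ) (C : J → Matrix ι ι ℝ) (i : J) (z : (J → ℝ) × (J → ℝ)) :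
    lin ψ C z.1 - lin ψ C (sw {i} z).1 = (ψ (z.1 i) - ψ (z.2 i)) • C i := by
  unfold lin
  rw [← Finset.sum_sub_distrib, Finset.sum_eq_single i]
  · simp [sw, sub_smul]
  · intro j _ hj; simp [sw, hj]
  · simp

lemma gl (h : Good ν L) {ψ : ℝ → ℝ} (hψ : Continuous ψ) {C : J → Matrix ι ι ℝ} (hC : ∀ i, (C i).IsHermitian)
    (m : ℝ) (hm : ∀ i, ∫ u, ψ u ∂(ν i) = m) (c : ℝ)
    (hc : ∀ u v, |u| ≤ L → |v| ≤ L → (ψ u - ψ v) ^ 2 ≤ c * (u ^ 2 + v ^ 2))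
    (p : ℝ) (hp : 4 ≤ p) :
    ∫ x, (fm (pw p) (lin ψ C x)).trace ∂(Measure.pi ν) ≤
      m * ∫ x, ((∑ i, C i) * fm (sg p) (lin ψ C x)).trace ∂(Measure.pi ν) +
      c * (p - 1) * ∑ i, ∫ x, ((x i) ^ 2 + 1) * (C i * C i * fm (pw (p - 2)) (lin ψ C x)).trace ∂(Measure.pi ν) := by
  haveI := h.prob
  have hY := lin_herm ψ hC
  have cg : Continuous fun x => fm (sg p) (lin ψ C x) :=
    continuous_fm (continuous_lin hψ C) hY (LL_sg (by linarith))
  have ch : Continuous fun x => fm (pw (p - 2)) (lin ψ C x) :=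
    continuous_fm (continuous_lin hψ C) hY (LL_pw (by linarith))
  set G : J → (J → ℝ) → ℝ := fun i x => (C i * fm (sg p) (lin ψ C x)).trace with hG
  set H : J → (J → ℝ) → ℝ := fun i x => (C i * C i * fm (pw (p - 2)) (lin ψ C x)).trace with hH
  have cG : ∀ i, Continuous (G i) := fun i => (continuous_const.matrix_mul cg).matrix_trace
  have cH : ∀ i, Continuous (H i) := fun i => (continuous_const.matrix_mul ch).matrix_trace
  have Hnn : ∀ i x, 0 ≤ H i x := by
    intro i x
    simp only [hH]
    rw [tr_sq_left_mul (hC i) (hY x)]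
    refine Finset.sum_nonneg fun j _ => Finset.sum_nonneg fun k _ => ?_
    exact mul_nonneg (wt_nonneg _ _ _ _) (mul_nonneg (mul_self_nonneg _) (pw_nonneg _ _))
  -- expand the left side
  have e1 : ∀ x, (fm (pw p) (lin ψ C x)).trace = ∑ i, ψ (x i) * G i x := by
    intro x
    have : fm (pw p) (lin ψ C x) = lin ψ C x * fm (sg p) (lin ψ C x) := by
      conv_rhs => enter [1]; rw [← fm_id (hY x)]
      rw [fm_mul (hY x)]
      congr 1; ext u; rw [mul_sg (by linarith)]
    rw [this]
    conv_lhs => enter [1, 1]; unfold lin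
    rw [Finset.sum_mul, Matrix.trace_sum]
    refine Finset.sum_congr rfl fun i _ => ?_
    rw [Matrix.smul_mul, Matrix.trace_smul, smul_eq_mul]
  have e2 : ∀ x, ((∑ i, C i) * fm (sg p) (lin ψ C x)).trace = ∑ i, G i x := by
    intro x; rw [Finset.sum_mul, Matrix.trace_sum]
  simp_rw [e1, e2]
  rw [integral_finsetSum _ (fun i _ => h.int1 (by have := cG i; fun_prop)),
    integral_finsetSum _ (fun i _ => h.int1 (cG i)), Finset.mul_sum, Finset.mul_sum, ← Finset.sum_add_distrib]
  refine Finset.sum_le_sum fun i _ => ?_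
  set P := (Measure.pi ν).prod (Measure.pi ν)
  have csw : Continuous fun z : (J → ℝ) × (J → ℝ) => (sw {i} z).1 := (continuous_sw {i}).fst
  have cGi := cG i
  have cHi := cH i
  have s1 : ∀ z : (J → ℝ) × (J → ℝ), (sw {i} z).1 i = z.2 i := by intro z; simp [sw]
  have s2 : ∀ z : (J → ℝ) × (J → ℝ), (sw {i} z).2 i = z.1 i := by intro z; simp [sw]
  have a0 : ∫ z, (ψ (z.1 i) - ψ (z.2 i)) * (G i z.1 - G i (sw {i} z).1) ∂P =
      2 * (∫ x, ψ (x i) * G i x ∂(Measure.pi ν) - m * ∫ x, G i x ∂(Measure.pi ν)) := by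
    have t1 : ∫ z, ψ (z.1 i) * G i z.1 ∂P = ∫ x, ψ (x i) * G i x ∂(Measure.pi ν) :=
      int_fst (fun x => ψ (x i) * G i x)
    have t2 : ∫ z, ψ (z.2 i) * G i z.1 ∂P = m * ∫ x, G i x ∂(Measure.pi ν) := by
      rw [int_snd_fst i hψ, hm]
    have t3 : ∫ z, ψ (z.1 i) * G i (sw {i} z).1 ∂P = m * ∫ x, G i x ∂(Measure.pi ν) := by
      rw [← t2, ← int_sw {i} (Φ := fun z => ψ (z.2 i) * G i z.1) (by fun_prop)]
      simp only [s2]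
      rfl
    have t4 : ∫ z, ψ (z.2 i) * G i (sw {i} z).1 ∂P = ∫ x, ψ (x i) * G i x ∂(Measure.pi ν) := by
      rw [← t1, ← int_sw {i} (Φ := fun z => ψ (z.1 i) * G i z.1) (by fun_prop)]
      simp only [s1]
      rfl
    have : ∀ z : (J → ℝ) × (J → ℝ), (ψ (z.1 i) - ψ (z.2 i)) * (G i z.1 - G i (sw {i} z).1) =
      (ψ (z.1 i) * G i z.1 - ψ (z.2 i) * G i z.1) - (ψ (z.1 i) * G i (sw {i} z).1 - ψ (z.2 i) * G i (sw {i} z).1) := by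
      intro z; ring
    simp_rw [this]
    rw [integral_sub (h.int2 (by fun_prop)) (h.int2 (by fun_prop)), integral_sub (h.int2 (by fun_prop)) (h.int2 (by fun_prop)),
      integral_sub (h.int2 (by fun_prop)) (h.int2 (by fun_prop)), t1, t2, t3, t4]
    ring
  have b0 : ∫ z, (c * (p - 1)) * ((z.1 i ^ 2 + z.2 i ^ 2) * (H i z.1 + H i (sw {i} z).1)) ∂P =
      2 * (c * (p - 1) * ∫ x, ((x i) ^ 2 + 1) * H i x ∂(Measure.pi ν)) := by
    have t1 : ∫ z, (z.1 i ^ 2 + z.2 i ^ 2) * H i z.1 ∂P = ∫ x, ((x i) ^ 2 + 1) * H i x ∂(Measure.pi ν) := by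
      have u1 := int_fst (ν := ν) (fun x => (x i) ^ 2 * H i x)
      have u2 := int_snd_fst (ν := ν) i (ψ := fun u => u ^ 2) (by fun_prop) (H i)
      rw [h.var i] at u2
      simp_rw [add_mul]
      rw [integral_add (h.int2 (by fun_prop)) (h.int2 (by fun_prop)), integral_add (h.int1 (by fun_prop)) (h.int1 (by fun_prop)),
        u1, u2]
      simp only [one_mul]
    have t2 : ∫ z, (z.1 i ^ 2 + z.2 i ^ 2) * H i (sw {i} z).1 ∂P = ∫ x, ((x i) ^ 2 + 1) * H i x ∂(Measure.pi ν) := by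
      rw [← t1, ← int_sw {i} (Φ := fun z => (z.1 i ^ 2 + z.2 i ^ 2) * H i z.1) (by fun_prop)]
      simp only [s1, s2]
      congr 1; ext z; ring
    rw [integral_const_mul]
    simp_rw [mul_add]
    rw [integral_add (h.int2 (by fun_prop)) (h.int2 (by fun_prop)), t1, t2]
    ring
  have hle : ∫ z, (ψ (z.1 i) - ψ (z.2 i)) * (G i z.1 - G i (sw {i} z).1) ∂P ≤ 
      ∫ z, (c * (p - 1)) * ((z.1 i ^ 2 + z.2 i ^ 2) * (H i z.1 + H i (sw {i} z).1)) ∂P := by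
    refine integral_mono_ae (h.int2 (by fun_prop)) (h.int2 (by fun_prop)) ?_
    filter_upwards [h.ae2] with z hz
    have mv := mean_value_trace (hY z.1) (hY (sw {i} z).1) (sg p) (fun u => (p - 1) * pw (p - 2) u)
      (sg_mvt (by linarith))
    rw [lin_sub, fm_smul, fm_smul] at mv
    simp only [Matrix.smul_mul, Matrix.mul_smul, Matrix.trace_smul, smul_eq_mul, Matrix.mul_sub, Matrix.trace_sub] at mv
    change (ψ (z.1 i) - ψ (z.2 i)) * G i z.1 - (ψ (z.1 i) - ψ (z.2 i)) * G i (sw {i} z).1 ≤ 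
      (p - 1) * ((ψ (z.1 i) - ψ (z.2 i)) * ((ψ (z.1 i) - ψ (z.2 i)) * H i z.1)) +
      (p - 1) * ((ψ (z.1 i) - ψ (z.2 i)) * ((ψ (z.1 i) - ψ (z.2 i)) * H i (sw {i} z).1)) at mv
    rw [← mul_sub] at mv
    refine mv.trans ?_
    have hd := hc (z.1 i) (z.2 i) (hz.1 i) (hz.2 i)
    have hHH : 0 ≤ (p - 1) * (H i z.1 + H i (sw {i} z).1) :=
      mul_nonneg (by linarith) (add_nonneg (Hnn _ _) (Hnn _ _))
    have := mul_le_mul_of_nonneg_right hd hHH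
    linarith
  rw [a0, b0] at hle
  linarith

end QR

open MeasureTheory ProbabilityTheory Matrix
open scoped BigOperators ENNReal
namespace QR

section young
variable {ι : Type*} [Fintype ι] [DecidableEq ι]

lemma tr_mono2 {A B : Matrix ι ι ℝ} (hA : A.IsHermitian) (hB : B.IsHermitian) {f g f1 g1 f2 g2 : ℝ → ℝ}
    (h : ∀ a b, f a * g b ≤ f1 a * g1 b + f2 a * g2 b) :
    (fm f A * fm g B).trace ≤ (fm f1 A * fm g1 B).trace + (fm f2 A * fm g2 B).trace := by
  rw [tr_fm_mul hA hB, tr_fm_mul hA hB, tr_fm_mul hA hB]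
  simp only [← Finset.sum_add_distrib, ← mul_add]
  exact Finset.sum_le_sum fun j _ => Finset.sum_le_sum fun k _ =>
    mul_le_mul_of_nonneg_left (h _ _) (wt_nonneg _ _ _ _)

lemma tr_young {A B : Matrix ι ι ℝ} (hA : A.IsHermitian) (hB : B.IsHermitian) {g f1 g1 : ℝ → ℝ}
    (h : ∀ a b, a * g b ≤ f1 a + g1 b) :
    (A * fm g B).trace ≤ (fm f1 A).trace + (fm g1 B).trace := by
  have := tr_mono2 hA hB (f := fun u => u) (g := g) (f1 := f1) (g1 := fun _ => 1) (f2 := fun _ => 1) (g2 := g1)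
    (by intro a b; simpa using h a b)
  simpa [fm_id hA, fm_one hA, fm_one hB] using this

lemma tr_smul_fm (c : ℝ) (f : ℝ → ℝ) (A : Matrix ι ι ℝ) :
    (fm (fun u => c * f u) A).trace = c * (fm f A).trace := by
  rw [fm_smul, trace_smul, smul_eq_mul]

lemma tr_fm_mono {A : Matrix ι ι ℝ} (hA : A.IsHermitian) {f g : ℝ → ℝ} (h : ∀ u, f u ≤ g u) :
    (fm f A).trace ≤ (fm g A).trace := by
  rw [tr_fm hA, tr_fm hA]; exact Finset.sum_le_sum fun i _ => h _

lemma tr_pw_nonneg (s : ℝ) (A : Matrix ι ι ℝ) : 0 ≤ (fm (pw s) A).trace := by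
  by_cases h : A.IsHermitian
  · rw [tr_fm h]; exact Finset.sum_nonneg fun i _ => pw_nonneg _ _
  · rw [fm, dif_neg h]; simp

lemma am {a w q : ℝ} (ha : 0 ≤ a) (hw : 0 ≤ w) (hq : 1 < q) : a * w ^ (q - 1) ≤ a ^ q + w ^ q := by
  have e : ∀ u : ℝ, 0 ≤ u → u * u ^ (q - 1) = u ^ q := by
    intro u hu
    rcases hu.eq_or_lt with rfl | hu
    · rw [Real.zero_rpow (by linarith : q ≠ 0)]; simp
    · rw [mul_comm, ← Real.rpow_add_one hu.ne']; congr 1; ring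
  rcases le_total a w with h | h
  · calc a * w ^ (q - 1) ≤ w * w ^ (q - 1) := by gcongr
      _ = w ^ q := e w hw
      _ ≤ _ := by have := Real.rpow_nonneg ha q; linarith
  · calc a * w ^ (q - 1) ≤ a * a ^ (q - 1) := by
          have : w ^ (q - 1) ≤ a ^ (q - 1) := Real.rpow_le_rpow hw h (by linarith)
          gcongr
      _ = a ^ q := e a ha
      _ ≤ _ := by have := Real.rpow_nonneg hw q; linarith

lemma pw_two_mul (s u : ℝ) : pw (2 * s) u = (u ^ 2) ^ s := by
  unfold pw
  rw [Real.rpow_mul (abs_nonneg u)]; congr 1; norm_num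

lemma scalA {q v y : ℝ} (hq : 4 ≤ q) :
    2 * (2 * q - 1) * (v * pw (2 * q - 2) y) ≤ 
      1 / 4 * (8 * (2 * q - 1)) ^ q * pw q v + 1 / 4 * pw (2 * q) y := by
  have h := am (a := 8 * (2 * q - 1) * |v|) (w := y ^ 2) (q := q) (by positivity [show (0:ℝ) ≤ 2 * q - 1 by linarith]) (sq_nonneg y) (by linarith)
  rw [Real.mul_rpow (by linarith) (abs_nonneg v)] at h
  rw [show 2 * q - 2 = 2 * (q - 1) by ring, pw_two_mul, pw_two_mul, pw]
  have : v * (y ^ 2) ^ (q - 1) ≤ |v| * (y ^ 2) ^ (q - 1) := by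
    gcongr; exact le_abs_self v
  nlinarith [show (0:ℝ) ≤ 2 * q - 1 by linarith]

lemma scalB {q l b z : ℝ} (hq : 4 ≤ q) (hl : 0 ≤ l) :
    (b * b) * (b * b) * ((q - 1) * l * pw (q - 2) z) ≤ 
      1 / 4 * (b * b) * pw (q - 1) z + 1 / 4 * (4 * (q - 1) * l) ^ (q - 1) * pw (2 * q) b := by
  have h := am (a := 4 * (q - 1) * l * (b * b)) (w := |z|) (q := q - 1)
    (mul_nonneg (mul_nonneg (by linarith) hl) (mul_self_nonneg b)) (abs_nonneg z) (by linarith)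
  rw [Real.mul_rpow (mul_nonneg (by linarith) hl) (mul_self_nonneg b), show q - 1 - 1 = q - 2 by ring] at h
  rw [pw_two_mul]
  have e : (b ^ 2) ^ q = (b * b) * (b * b) ^ (q - 1) := by
    rcases eq_or_ne b 0 with rfl | hb
    · simp; rw [Real.zero_rpow (by linarith)]
    · rw [mul_comm, ← Real.rpow_add_one (by positivity), pow_two]; congr 1; ring
  rw [e, pw, pw]
  nlinarith [mul_le_mul_of_nonneg_left h (mul_self_nonneg b)]

lemma scalC {q v z : ℝ} (hq : 4 ≤ q) :
    v * (sg q z + 1 / 4 * pw (q - 1) z) ≤ 1 / 4 * 5 ^ q * pw q v + 1 / 4 * pw q z := by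
  have h := am (a := 5 * |v|) (w := |z|) (q := q) (by positivity) (abs_nonneg z) (by linarith)
  rw [Real.mul_rpow (by linarith) (abs_nonneg v)] at h
  have h1 : v * sg q z ≤ |v| * pw (q - 1) z := by
    rw [← abs_sg (by linarith : 2 < q), ← abs_mul]; exact le_abs_self _
  have h2 : v * pw (q - 1) z ≤ |v| * pw (q - 1) z := by
    have := pw_nonneg (q - 1) z
    gcongr; exact le_abs_self v
  unfold pw at *
  linarith

lemma sq_herm {A : Matrix ι ι ℝ} (h : A.IsHermitian) : (A * A).IsHermitian := by
  unfold IsHermitian; rw [conjTranspose_mul, h.eq]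

end young
end QR

open MeasureTheory ProbabilityTheory Matrix
open scoped BigOperators ENNReal
namespace QR

variable {J : Type*} [Fintype J] [DecidableEq J]
variable {ι : Type*} [Fintype ι] [DecidableEq ι] {ν : J → Measure ℝ} {L : ℝ}

lemma sum_split (B W : Matrix ι ι ℝ) (C : J → Matrix ι ι ℝ) (x : J → ℝ) :
    ∑ i, ((x i) ^ 2 + 1) * (C i * W).trace = (lin (fun u => u ^ 2) C x * W).trace + ((∑ i, C i) * W).trace := by
  unfold lin
  rw [Finset.sum_mul, Finset.sum_mul, Matrix.trace_sum, Matrix.trace_sum, ← Finset.sum_add_distrib]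
  refine Finset.sum_congr rfl fun i _ => ?_
  rw [Matrix.smul_mul, Matrix.trace_smul, smul_eq_mul]; ring

lemma stepA (h : Good ν L) {B : J → Matrix ι ι ℝ} (hB : ∀ i, (B i).IsHermitian) (q : ℝ) (hq : 4 ≤ q) :
    ∫ x, (fm (pw (2 * q)) (lin (fun u => u) B x)).trace ∂(Measure.pi ν) ≤
      1 / 2 * (8 * (2 * q - 1)) ^ q * (∫ x, (fm (pw q) (lin (fun u => u ^ 2) (fun i => B i * B i) x)).trace ∂(Measure.pi ν)
        + (fm (pw q) (∑ i, B i * B i)).trace) := by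
  haveI := h.prob
  have hC : ∀ i, (B i * B i).IsHermitian := fun i => sq_herm (hB i)
  have hX := lin_herm (fun u => u) hB
  have hZ := lin_herm (fun u => u ^ 2) hC
  have hQ : (∑ i, B i * B i).IsHermitian := by
    have := lin_herm (fun u => 1) hC 0
    simpa [lin] using this
  have cX : Continuous (lin (fun u => u) B) := continuous_lin continuous_id B
  have cZ : Continuous (lin (fun u => u ^ 2) (fun i => B i * B i)) := continuous_lin (by fun_prop) _
  have k1 : Continuous fun x => (fm (pw (2 * q)) (lin (fun u => u) B x)).trace :=
    (continuous_fm cX hX (LL_pw (by linarith))).matrix_trace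
  have k2 : Continuous fun x => (fm (pw q) (lin (fun u => u ^ 2) (fun i => B i * B i) x)).trace :=
    (continuous_fm cZ hZ (LL_pw (by linarith))).matrix_trace
  have k3 : Continuous fun x => fm (pw (2 * q - 2)) (lin (fun u => u) B x) :=
    (continuous_fm cX hX (LL_pw (by linarith)))
  have k4 : ∀ i, Continuous fun x : J → ℝ => ((x i) ^ 2 + 1) * (B i * B i * fm (pw (2 * q - 2)) (lin (fun u => u) B x)).trace := by
    intro i
    have : Continuous fun x => (B i * B i * fm (pw (2 * q - 2)) (lin (fun u => u) B x)).trace :=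
      (continuous_const.matrix_mul k3).matrix_trace
    fun_prop
  have g := gl h (ψ := fun u => u) continuous_id hB 0 h.mean 2 (by intro u v _ _; nlinarith [sq_nonneg (u + v)]) (2 * q) (by linarith)
  rw [zero_mul, zero_add, ← integral_finsetSum _ (fun i _ => h.int1 (k4 i)), ← integral_const_mul] at g
  have : ∫ x, 2 * (2 * q - 1) * ∑ i, ((x i) ^ 2 + 1) * (B i * B i * fm (pw (2 * q - 2)) (lin (fun u => u) B x)).trace ∂(Measure.pi ν)
     ≤ ∫ x, (1 / 4 * (8 * (2 * q - 1)) ^ q * ((fm (pw q) (lin (fun u => u ^ 2) (fun i => B i * B i) x)).trace 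
        + (fm (pw q) (∑ i, B i * B i)).trace) + 1 / 2 * (fm (pw (2 * q)) (lin (fun u => u) B x)).trace) ∂(Measure.pi ν) := by
    refine integral_mono (h.int1 ?_) (h.int1 ?_) ?_
    · exact continuous_const.mul (continuous_finset_sum _ fun i _ => k4 i)
    · fun_prop
    intro x
    simp only
    rw [sum_split 0 _ (fun i => B i * B i)]
    have y1 := tr_young (hZ x) (hX x) (fun a b => by
      have := scalA (q := q) (v := a) (y := b) hq
      rwa [mul_left_comm] at this : ∀ a b, a * ((2 * (2 * q - 1)) * pw (2 * q - 2) b) ≤ 1 / 4 * (8 * (2 * q - 1)) ^ q * pw q a + 1 / 4 * pw (2 * q) b)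
    have y2 := tr_young hQ (hX x) (fun a b => by
      have := scalA (q := q) (v := a) (y := b) hq
      rwa [mul_left_comm] at this : ∀ a b, a * ((2 * (2 * q - 1)) * pw (2 * q - 2) b) ≤ 1 / 4 * (8 * (2 * q - 1)) ^ q * pw q a + 1 / 4 * pw (2 * q) b)
    rw [tr_smul_fm, tr_smul_fm, fm_smul, Matrix.mul_smul, trace_smul, smul_eq_mul] at y1 y2
    linarith
  replace this := g.trans this
  rw [integral_add (h.int1 (by fun_prop)) (h.int1 (by fun_prop)), integral_const_mul, integral_const_mul,
    integral_add (h.int1 (by fun_prop)) (h.int1 (by fun_prop))] at this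
  simp only [integral_const, probReal_univ, one_smul] at this
  linarith

lemma stepB (h : Good ν L) {B : J → Matrix ι ι ℝ} (hB : ∀ i, (B i).IsHermitian) (q : ℝ) (hq : 4 ≤ q) :
    ∫ x, (fm (pw q) (lin (fun u => u ^ 2) (fun i => B i * B i) x)).trace ∂(Measure.pi ν) ≤
      1 / 2 * 5 ^ q * (fm (pw q) (∑ i, B i * B i)).trace +
        (4 * (q - 1) * L ^ 2) ^ (q - 1) * ∑ i, (fm (pw (2 * q)) (B i)).trace := by
  haveI := h.prob
  have hC : ∀ i, (B i * B i).IsHermitian := fun i => sq_herm (hB i)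
  have hZ := lin_herm (fun u => u ^ 2) hC
  have hQ : (∑ i, B i * B i).IsHermitian := by
    have := lin_herm (fun u => 1) hC 0
    simpa [lin] using this
  have cZ : Continuous (lin (fun u => u ^ 2) (fun i => B i * B i)) := continuous_lin (by fun_prop) _
  set Z := lin (fun u => u ^ 2) (fun i => B i * B i) with hZdef
  set Q := ∑ i, B i * B i with hQdef
  set D := (4 * (q - 1) * L ^ 2) ^ (q - 1) with hD
  have k2 : Continuous fun x => (fm (pw q) (Z x)).trace :=
    (continuous_fm cZ hZ (LL_pw (by linarith))).matrix_trace
  have k3 : Continuous fun x => fm (pw (q - 2)) (Z x) :=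
    (continuous_fm cZ hZ (LL_pw (by linarith)))
  have k5 : Continuous fun x => (Q * fm (sg q) (Z x)).trace :=
    (continuous_const.matrix_mul (continuous_fm cZ hZ (LL_sg (by linarith)))).matrix_trace
  have k4 : ∀ i, Continuous fun x : J → ℝ => ((x i) ^ 2 + 1) * ((B i * B i) * (B i * B i) * fm (pw (q - 2)) (Z x)).trace := by
    intro i
    have : Continuous fun x => ((B i * B i) * (B i * B i) * fm (pw (q - 2)) (Z x)).trace :=
      (continuous_const.matrix_mul k3).matrix_trace
    fun_prop
  have g := gl h (ψ := fun u => u ^ 2) (by fun_prop) hC 1 h.var (L ^ 2) (by 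
    intro u v hu hv
    have a1 : u ^ 2 ≤ L ^ 2 := by rw [← sq_abs u]; gcongr
    have a2 : v ^ 2 ≤ L ^ 2 := by rw [← sq_abs v]; gcongr
    nlinarith [sq_nonneg u, sq_nonneg v, mul_nonneg (sq_nonneg u) (sq_nonneg v), mul_nonneg (sq_nonneg u) (sub_nonneg.2 a1), mul_nonneg (sq_nonneg v) (sub_nonneg.2 a2)]) q hq
  rw [one_mul, ← integral_finsetSum _ (fun i _ => h.int1 (k4 i)), ← integral_const_mul, 
    ← integral_add (f := fun x => (Q * fm (sg q) (Z x)).trace) (g := fun x => L ^ 2 * (q - 1) * ∑ i, ((x i) ^ 2 + 1) * ((B i * B i) * (B i * B i) * fm (pw (q - 2)) (Z x)).trace) (h.int1 k5) (h.int1 (continuous_const.mul (continuous_finset_sum _ fun i _ => k4 i)))] at g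
  have : ∫ x, ((Q * fm (sg q) (Z x)).trace + L ^ 2 * (q - 1) * ∑ i, ((x i) ^ 2 + 1) * ((B i * B i) * (B i * B i) * fm (pw (q - 2)) (Z x)).trace) ∂(Measure.pi ν)
     ≤ ∫ x, (1 / 2 * (fm (pw q) (Z x)).trace + 1 / 4 * 5 ^ q * (fm (pw q) Q).trace + 
        ∑ i, ((x i) ^ 2 + 1) * (1 / 4 * D * (fm (pw (2 * q)) (B i)).trace)) ∂(Measure.pi ν) := by
    refine integral_mono (h.int1 ?_) (h.int1 ?_) ?_
    · exact k5.add (continuous_const.mul (continuous_finset_sum _ fun i _ => k4 i))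
    · fun_prop
    intro x
    simp only
    have y1 : ∀ i, (q - 1) * L ^ 2 * ((B i * B i) * (B i * B i) * fm (pw (q - 2)) (Z x)).trace ≤
        1 / 4 * ((B i * B i) * fm (pw (q - 1)) (Z x)).trace + 1 / 4 * D * (fm (pw (2 * q)) (B i)).trace := by
      intro i
      have := tr_mono2 (hB i) (hZ x) (f := fun b => (b * b) * (b * b)) (g := fun z => (q - 1) * L ^ 2 * pw (q - 2) z)
        (f1 := fun b => 1 / 4 * (b * b)) (g1 := pw (q - 1)) (f2 := fun b => 1 / 4 * D * pw (2 * q) b) (g2 := fun _ => 1)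
        (by intro b z; simpa using scalB (q := q) (l := L ^ 2) (b := b) (z := z) hq (sq_nonneg L))
      rw [fm_one (hZ x), mul_one, tr_smul_fm, fm_smul, fm_smul, ← fm_mul (hB i) (fun b => b * b), ← fm_mul (hB i) (fun b => b),
        fm_id (hB i), Matrix.mul_smul, Matrix.smul_mul, trace_smul, trace_smul] at this
      simpa using this
    have y2 : L ^ 2 * (q - 1) * ∑ i, ((x i) ^ 2 + 1) * ((B i * B i) * (B i * B i) * fm (pw (q - 2)) (Z x)).trace ≤
       1 / 4 * ((Z x * fm (pw (q - 1)) (Z x)).trace + (Q * fm (pw (q - 1)) (Z x)).trace) +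
        ∑ i, ((x i) ^ 2 + 1) * (1 / 4 * D * (fm (pw (2 * q)) (B i)).trace) := by
      rw [← sum_split 0 _ (fun i => B i * B i), Finset.mul_sum, Finset.mul_sum, ← Finset.sum_add_distrib]
      refine Finset.sum_le_sum fun i _ => ?_
      have := mul_le_mul_of_nonneg_left (y1 i) (by positivity : 0 ≤ (x i) ^ 2 + 1)
      linarith
    have y3 : (Z x * fm (pw (q - 1)) (Z x)).trace ≤ (fm (pw q) (Z x)).trace := by
      conv_lhs => enter [1, 1]; rw [← fm_id (hZ x)]
      rw [fm_mul (hZ x)]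
      refine tr_fm_mono (hZ x) fun u => ?_
      have := mul_pw_le (s := q - 1) (by linarith) u
      rwa [sub_add_cancel] at this
    have y4 := tr_young hQ (hZ x) (fun v z => scalC (v := v) (z := z) hq)
    rw [tr_smul_fm, tr_smul_fm] at y4
    have y5 : (Q * fm (fun z => sg q z + 1 / 4 * pw (q - 1) z) (Z x)).trace = 
       (Q * fm (sg q) (Z x)).trace + 1 / 4 * (Q * fm (pw (q - 1)) (Z x)).trace := by
      rw [tr_left_mul hQ (hZ x), tr_left_mul hQ (hZ x), tr_left_mul hQ (hZ x)]
      simp only [Finset.mul_sum, ← Finset.sum_add_distrib]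
      refine Finset.sum_congr rfl fun j _ => Finset.sum_congr rfl fun k _ => ?_
      ring
    rw [y5] at y4
    linarith
  have e : ∀ i, ∫ x, ((x i) ^ 2 + 1) * (1 / 4 * D * (fm (pw (2 * q)) (B i)).trace) ∂(Measure.pi ν) = 1 / 2 * D * (fm (pw (2 * q)) (B i)).trace := by
    intro i
    rw [integral_mul_const, integral_add (h.int1 (by fun_prop)) (h.int1 (by fun_prop)), int_eval i (ψ := fun u => u ^ 2) (by fun_prop), h.var]
    simp; ring
  replace this := g.trans this
  rw [integral_add (h.int1 (by fun_prop)) (h.int1 (by fun_prop)), integral_finsetSum _ (fun i _ => h.int1 (by fun_prop)), 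
    integral_add (h.int1 (by fun_prop)) (h.int1 (by fun_prop)), integral_const_mul, Finset.sum_congr rfl (fun i _ => e i), ← Finset.mul_sum] at this
  simp only [integral_const, probReal_univ, one_smul] at this
  linarith

/-- Hermitian linear moment bound -/
lemma herm_lin (h : Good ν L) {B : J → Matrix ι ι ℝ} (hB : ∀ i, (B i).IsHermitian) (q : ℝ) (hq : 4 ≤ q) :
    ∫ x, (fm (pw (2 * q)) (lin (fun u => u) B x)).trace ∂(Measure.pi ν) ≤
      (64 * q ^ 2) ^ q * ((fm (pw q) (∑ i, B i * B i)).trace + (L ^ 2) ^ q * ∑ i, (fm (pw (2 * q)) (B i)).trace) := by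
  have a := stepA h hB q hq
  have b := stepB h hB q hq
  set TQ := (fm (pw q) (∑ i, B i * B i)).trace
  set S := ∑ i, (fm (pw (2 * q)) (B i)).trace
  have hT : 0 ≤ TQ := tr_pw_nonneg _ _
  have hS : 0 ≤ S := Finset.sum_nonneg fun i _ => tr_pw_nonneg _ _
  have hL := h.one_le
  have hL2 : 1 ≤ L ^ 2 := by nlinarith
  have e1 : (8 * (2 * q - 1)) ^ q ≤ (16 * q) ^ q := Real.rpow_le_rpow (by linarith) (by linarith) (by linarith)
  have e2 : (16 * q) ^ q * 5 ^ q ≤ (64 * q ^ 2) ^ q := by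
    rw [← Real.mul_rpow (by linarith) (by norm_num)]
    exact Real.rpow_le_rpow (by linarith) (by nlinarith) (by linarith)
  have e3 : (1:ℝ) ≤ 5 ^ q := Real.one_le_rpow (by norm_num) (by linarith)
  have e4 : (4 * (q - 1) * L ^ 2) ^ (q - 1) ≤ (4 * q) ^ q * (L ^ 2) ^ q := by
    rw [← Real.mul_rpow (by linarith) (by positivity)]
    calc (4 * (q - 1) * L ^ 2) ^ (q - 1) ≤ (4 * q * L ^ 2) ^ (q - 1) := by
          refine Real.rpow_le_rpow (mul_nonneg (by linarith) (by positivity)) ?_ (by linarith)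
          nlinarith
      _ ≤ _ := Real.rpow_le_rpow_of_exponent_le (by nlinarith) (by linarith)
  have e5 : (16 * q) ^ q * (4 * q) ^ q = (64 * q ^ 2) ^ q := by
    rw [← Real.mul_rpow (by linarith) (by linarith)]; congr 1; ring
  have p1 : (0:ℝ) ≤ (8 * (2 * q - 1)) ^ q := Real.rpow_nonneg (by linarith) _
  have p2 : (0:ℝ) ≤ (16 * q) ^ q := Real.rpow_nonneg (by linarith) _
  have p3 : (0:ℝ) ≤ (L ^ 2) ^ q := Real.rpow_nonneg (by positivity) _
  calc _ ≤ 1 / 2 * (8 * (2 * q - 1)) ^ q * ((1 / 2 * 5 ^ q * TQ + (4 * (q - 1) * L ^ 2) ^ (q - 1) * S) + TQ) := by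
        refine a.trans (mul_le_mul_of_nonneg_left (by linarith) (by linarith))
    _ ≤ (8 * (2 * q - 1)) ^ q * (5 ^ q * TQ + (4 * (q - 1) * L ^ 2) ^ (q - 1) * S) := by
        have : (0:ℝ) ≤ (4 * (q - 1) * L ^ 2) ^ (q - 1) * S := 
          mul_nonneg (Real.rpow_nonneg (mul_nonneg (by linarith) (by positivity)) _) hS
        have h2 : 1 / 2 * ((1 / 2 * 5 ^ q * TQ + (4 * (q - 1) * L ^ 2) ^ (q - 1) * S) + TQ) ≤ (5 ^ q * TQ + (4 * (q - 1) * L ^ 2) ^ (q - 1) * S) := by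
          nlinarith
        have := mul_le_mul_of_nonneg_left h2 p1
        linarith
    _ ≤ (16 * q) ^ q * (5 ^ q * TQ + ((4 * q) ^ q * (L ^ 2) ^ q) * S) := by
        refine mul_le_mul e1 (by gcongr) (add_nonneg (by positivity) (mul_nonneg (Real.rpow_nonneg (mul_nonneg (by linarith) (by positivity)) _) hS)) p2
    _ = (16 * q) ^ q * 5 ^ q * TQ + ((16 * q) ^ q * (4 * q) ^ q) * ((L ^ 2) ^ q * S) := by ring
    _ ≤ (64 * q ^ 2) ^ q * TQ + (64 * q ^ 2) ^ q * ((L ^ 2) ^ q * S) := by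
        rw [e5]; gcongr
    _ = _ := by ring

end QR

open MeasureTheory ProbabilityTheory Matrix
open scoped BigOperators ENNReal
namespace QR

section sch
variable {R C : Type*} [Fintype R] [Fintype C] [DecidableEq R] [DecidableEq C]

lemma herm_tm {R C : Type*} [Fintype R] (A : Matrix R C ℝ) : (Aᵀ * A).IsHermitian := by
  unfold IsHermitian; simp

/-- `tr (AᵀA)^q` -/
noncomputable def T {R C : Type*} [Fintype R] [Fintype C] [DecidableEq C] (q : ℝ) (A : Matrix R C ℝ) : ℝ :=
  (fm (pw q) (Aᵀ * A)).trace

lemma eig_nonneg {R C : Type*} [Fintype R] [Fintype C] [DecidableEq C] (A : Matrix R C ℝ)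
    (h : (Aᵀ * A).IsHermitian) (i : C) : 0 ≤ h.eigenvalues i := by
  have := eigenvalues_conjTranspose_mul_self_nonneg A i
  exact this

lemma T_eq {R C : Type*} [Fintype R] [Fintype C] [DecidableEq C] (q : ℝ) (A : Matrix R C ℝ) :
    schattenPow q A = T q A := by
  unfold schattenPow T
  rw [tr_fm (herm_tm A)]
  refine Finset.sum_congr rfl fun i _ => ?_
  have := eig_nonneg A (herm_tm A) i
  rw [pw, abs_of_nonneg this]
  rfl

lemma T_nonneg {R C : Type*} [Fintype R] [Fintype C] [DecidableEq C] (q : ℝ) (A : Matrix R C ℝ) : 0 ≤ T q A := tr_pw_nonneg _ _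

lemma pw_zero' {q : ℝ} (hq : 0 < q) : pw q 0 = 0 := by
  unfold pw; rw [abs_zero, Real.zero_rpow hq.ne']

lemma T_transpose {q : ℝ} (hq : 0 < q) (A : Matrix R C ℝ) : T q Aᵀ = T q A := by
  unfold T
  rw [tr_fm_roots (herm_tm A), tr_fm_roots (herm_tm Aᵀ), transpose_transpose]
  have h := charpoly_mul_comm' A Aᵀ
  have h2 := congrArg (fun P : Polynomial ℝ => (P.roots.map (pw q)).sum) h
  rw [Polynomial.roots_mul (mul_ne_zero (pow_ne_zero _ Polynomial.X_ne_zero) (charpoly_monic _).ne_zero),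
    Polynomial.roots_mul (mul_ne_zero (pow_ne_zero _ Polynomial.X_ne_zero) (charpoly_monic _).ne_zero)] at h2
  simpa [pw_zero' hq, Multiset.map_nsmul, Multiset.sum_nsmul] using h2

lemma tr_fm_blocks {M : Matrix R R ℝ} {N : Matrix C C ℝ} (hM : M.IsHermitian) (hN : N.IsHermitian) (f : ℝ → ℝ) :
    (fm f (fromBlocks M 0 0 N)).trace = (fm f M).trace + (fm f N).trace := by
  rw [tr_fm_roots hM, tr_fm_roots hN, tr_fm_roots (IsHermitian.fromBlocks hM (by simp) hN), charpoly_fromBlocks_zero₁₂,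
    Polynomial.roots_mul (mul_ne_zero (charpoly_monic _).ne_zero (charpoly_monic _).ne_zero)]
  simp

lemma tr_fm_blockDiagonal {o : Type*} [Fintype o] [DecidableEq o] {M : o → Matrix R R ℝ} (hM : ∀ k, (M k).IsHermitian) (f : ℝ → ℝ) :
    (fm f (blockDiagonal M)).trace = ∑ k, (fm f (M k)).trace := by
  have hH : (blockDiagonal M).IsHermitian := by
    unfold IsHermitian; rw [blockDiagonal_conjTranspose]; congr 1; ext1 k; exact hM k
  have e : (blockDiagonal M).charpoly = ∏ k, (M k).charpoly := by
    unfold Matrix.charpoly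
    rw [← det_blockDiagonal]
    congr 1
    ext ⟨i, k⟩ ⟨j, l⟩
    by_cases hkl : k = l
    · subst hkl
      simp [charmatrix_apply, blockDiagonal_apply, diagonal_apply]
    · simp [charmatrix_apply, blockDiagonal_apply, diagonal_apply, hkl]
  rw [tr_fm_roots hH, e, Polynomial.roots_prod _ _ (Finset.prod_ne_zero_iff.2 fun k _ => (charpoly_monic _).ne_zero)]
  simp_rw [tr_fm_roots (hM _)]
  rw [Multiset.map_bind, Multiset.sum_bind]
  rfl

lemma T_blockDiagonal {o : Type*} [Fintype o] [DecidableEq o] (q : ℝ) (B : o → Matrix R C ℝ) :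
    T q (blockDiagonal B) = ∑ k, T q (B k) := by
  unfold T
  rw [← tr_fm_blockDiagonal (fun k => herm_tm (B k)), blockDiagonal_transpose, ← blockDiagonal_mul]

/-- Hermitian dilation -/
def hd (A : Matrix R C ℝ) : Matrix (R ⊕ C) (R ⊕ C) ℝ := fromBlocks 0 A Aᵀ 0

lemma hd_herm (A : Matrix R C ℝ) : (hd A).IsHermitian := by
  unfold hd; exact IsHermitian.fromBlocks (by simp [IsHermitian]) (by simp) (by simp [IsHermitian])

lemma hd_sq (A : Matrix R C ℝ) : hd A * hd A = fromBlocks (A * Aᵀ) 0 0 (Aᵀ * A) := by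
  unfold hd; rw [fromBlocks_multiply]; simp

lemma tr_sq_pw {ι : Type*} [Fintype ι] [DecidableEq ι] {H : Matrix ι ι ℝ} (hH : H.IsHermitian) (q : ℝ) :
    (fm (pw q) (H * H)).trace = (fm (pw (2 * q)) H).trace := by
  have : H * H = fm (fun u => u * u) H := by rw [← fm_mul hH, fm_id hH]
  rw [this, tr_fm_comp hH]
  congr 2; ext u
  rw [pw_two_mul, pw, abs_of_nonneg (mul_self_nonneg u), pow_two]

lemma tr_hd {q : ℝ} (hq : 0 < q) (A : Matrix R C ℝ) : (fm (pw (2 * q)) (hd A)).trace = 2 * T q A := by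
  rw [← tr_sq_pw (hd_herm A), hd_sq, tr_fm_blocks (by simpa using herm_tm Aᵀ) (herm_tm A)]
  have := T_transpose hq A
  unfold T at *
  rw [transpose_transpose] at this
  rw [this]; ring

lemma scal_young {p a b : ℝ} (hp : 2 < p) : a * sg p b ≤ 1 / p * pw p a + (1 - 1 / p) * pw p b := by
  have hc : p.HolderConjugate (p / (p - 1)) := Real.HolderConjugate.conjExponent (by linarith)
  have h := Real.young_inequality_of_nonneg (abs_nonneg a) (pw_nonneg (p - 1) b) hc
  have e : (pw (p - 1) b) ^ (p / (p - 1)) = pw p b := by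
    unfold pw; rw [← Real.rpow_mul (abs_nonneg b)]; congr 1; field_simp [show p - 1 ≠ 0 by linarith]
  rw [e] at h
  have h1 : a * sg p b ≤ |a| * pw (p - 1) b := by
    rw [← abs_sg (by linarith : 2 < p), ← abs_mul]; exact le_abs_self _
  refine h1.trans (h.trans (le_of_eq ?_))
  unfold pw
  have : p - 1 ≠ 0 := by linarith
  field_simp

lemma tr_conv {ι : Type*} [Fintype ι] [DecidableEq ι] {o : Type*} [Fintype o] {p : ℝ} (hp : 2 < p) (c : o → ℝ) (hc : ∀ s, 0 ≤ c s) (hc1 : ∑ s, c s = 1)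
    {H : o → Matrix ι ι ℝ} (hH : ∀ s, (H s).IsHermitian) (hS : (∑ s, c s • H s).IsHermitian) :
    (fm (pw p) (∑ s, c s • H s)).trace ≤ ∑ s, c s * (fm (pw p) (H s)).trace := by
  set S := ∑ s, c s • H s with hSdef
  have e : fm (pw p) S = S * fm (sg p) S := by
    conv_rhs => enter [1]; rw [← fm_id hS]
    rw [fm_mul hS]; congr 1; ext u; rw [mul_sg hp]
  have e2 : (fm (pw p) S).trace = ∑ s, c s * (H s * fm (sg p) S).trace := by
    rw [e]; conv_lhs => enter [1, 1]; rw [hSdef]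
    rw [Finset.sum_mul, trace_sum]
    refine Finset.sum_congr rfl fun i _ => ?_
    rw [Matrix.smul_mul, trace_smul, smul_eq_mul]
  have y : ∀ s, (H s * fm (sg p) S).trace ≤ 1 / p * (fm (pw p) (H s)).trace + (1 - 1 / p) * (fm (pw p) S).trace := by
    intro s
    have := tr_young (hH s) hS (fun a b => scal_young (a := a) (b := b) hp)
    rwa [tr_smul_fm, tr_smul_fm] at this
  have h3 : (fm (pw p) S).trace ≤ 1 / p * ∑ s, c s * (fm (pw p) (H s)).trace + (1 - 1 / p) * (fm (pw p) S).trace := by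
    calc _ = _ := e2
      _ ≤ ∑ s, c s * (1 / p * (fm (pw p) (H s)).trace + (1 - 1 / p) * (fm (pw p) S).trace) :=
        Finset.sum_le_sum fun s _ => mul_le_mul_of_nonneg_left (y s) (hc s)
      _ = _ := by
        simp_rw [mul_add]
        rw [Finset.sum_add_distrib, ← Finset.sum_mul, hc1, Finset.mul_sum, one_mul]
        congr 1
        exact Finset.sum_congr rfl fun s _ => by ring
  have hp0 : 0 < 1 / p := by positivity
  have h4 : 1 / p * (fm (pw p) S).trace ≤ 1 / p * ∑ s, c s * (fm (pw p) (H s)).trace := by linarith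
  exact le_of_mul_le_mul_left h4 hp0

lemma T_conv {o : Type*} [Fintype o] {q : ℝ} (hq : 4 ≤ q) (c : o → ℝ) (hc : ∀ s, 0 ≤ c s) (hc1 : ∑ s, c s = 1)
    (H : o → Matrix R C ℝ) : T q (∑ s, c s • H s) ≤ ∑ s, c s * T q (H s) := by
  have e : hd (∑ s, c s • H s) = ∑ s, c s • hd (H s) := by
    ext i j
    rcases i with i | i <;> rcases j with j | j <;> simp [hd, Matrix.sum_apply]
  have h := tr_conv (p := 2 * q) (by linarith) c hc hc1 (fun s => hd_herm (H s)) (by rw [← e]; exact hd_herm _)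
  rw [← e, tr_hd (by linarith)] at h
  simp_rw [tr_hd (by linarith : 0 < q)] at h
  have : ∑ s, c s * (2 * T q (H s)) = 2 * ∑ s, c s * T q (H s) := by
    rw [Finset.mul_sum]; exact Finset.sum_congr rfl fun s _ => by ring
  linarith

lemma T_loewner {R R' R'' C : Type*} [Fintype R] [Fintype R'] [Fintype R''] [Fintype C] [DecidableEq C] {q : ℝ} (hq : 4 ≤ q)
    (A : Matrix R C ℝ) (A' : Matrix R' C ℝ) (D : Matrix R'' C ℝ) (h : A'ᵀ * A' = Aᵀ * A + Dᵀ * D) : T q A ≤ T q A' := by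
  unfold T
  set M := Aᵀ * A with hM
  have hMh : M.IsHermitian := herm_tm A
  have e : fm (pw q) M = M * fm (sg q) M := by
    conv_rhs => enter [1]; rw [← fm_id hMh]
    rw [fm_mul hMh]; congr 1; ext u; rw [mul_sg (by linarith)]
  have h0 : 0 ≤ (Dᵀ * D * fm (sg q) M).trace := by
    rw [tr_left_mul (herm_tm D) hMh]
    refine Finset.sum_nonneg fun j _ => Finset.sum_nonneg fun k _ => mul_nonneg (wt_nonneg _ _ _ _) (mul_nonneg (eig_nonneg D _ _) ?_)
    exact mul_nonneg (eig_nonneg A _ _) (Real.rpow_nonneg (abs_nonneg _) _)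
  have y := tr_young (herm_tm A') hMh (fun a b => scal_young (a := a) (b := b) (p := q) (by linarith))
  rw [tr_smul_fm, tr_smul_fm] at y
  rw [show (A'ᵀ * A' * fm (sg q) M).trace = (fm (pw q) M).trace + (Dᵀ * D * fm (sg q) M).trace by
    rw [e, h, Matrix.add_mul, trace_add]] at y
  have hp0 : 0 < 1 / q := by positivity
  have h4 : 1 / q * (fm (pw q) M).trace ≤ 1 / q * (fm (pw q) (A'ᵀ * A')).trace := by linarith
  exact le_of_mul_le_mul_left h4 hp0

lemma T_rows {R R' C : Type*} [Fintype R] [Fintype R'] [Fintype C] [DecidableEq R] [DecidableEq C] {q : ℝ} (hq : 4 ≤ q)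
    (M : Matrix R C ℝ) (f : R' → R) (hf : Function.Injective f) (m : R' → ℝ) (hm : ∀ r, |m r| ≤ 1) :
    T q (Matrix.of fun r c => m r * M (f r) c) ≤ T q M := by
  classical
  set w : R → ℝ := fun s => ∑ r with f r = s, (m r) ^ 2 with hw
  have hw1 : ∀ s, w s ≤ 1 := by
    intro s
    simp only [hw]
    by_cases h : ∃ r, f r = s
    · obtain ⟨r, rfl⟩ := h
      have : (Finset.univ.filter fun r' => f r' = f r) = {r} := by
        ext r'; simp [hf.eq_iff]
      rw [this, Finset.sum_singleton, ← sq_abs]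
      have := hm r
      have := abs_nonneg (m r)
      nlinarith
    · have : (Finset.univ.filter fun r' => f r' = s) = ∅ := by
        ext r'; simp; exact fun h' => h ⟨r', h'⟩
      rw [this]; simp
  refine T_loewner hq _ _ (Matrix.of fun s c => Real.sqrt (1 - w s) * M s c) ?_
  ext c c'
  simp only [Matrix.add_apply, Matrix.mul_apply, Matrix.transpose_apply, Matrix.of_apply]
  have e1 : ∑ r, m r * M (f r) c * (m r * M (f r) c') = ∑ s, w s * (M s c * M s c') := by
    rw [← Finset.sum_fiberwise _ f]
    refine Finset.sum_congr rfl fun s _ => ?_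
    rw [hw, Finset.sum_mul]
    refine Finset.sum_congr rfl fun r hr => ?_
    rw [(Finset.mem_filter.1 hr).2]; ring
  rw [e1, ← Finset.sum_add_distrib]
  refine Finset.sum_congr rfl fun s _ => ?_
  have := Real.mul_self_sqrt (sub_nonneg.2 (hw1 s))
  linear_combination (-(M s c * M s c')) * this

lemma T_contr {R R' C C' : Type*} [Fintype R] [Fintype R'] [Fintype C] [Fintype C'] [DecidableEq R] [DecidableEq R'] [DecidableEq C]
    [DecidableEq C'] {q : ℝ} (hq : 4 ≤ q)
    (M : Matrix R C ℝ) (M' : Matrix R' C' ℝ) (f : R' → R) (g : C' → C) (hf : Function.Injective f) (hg : Function.Injective g)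
    (m1 : R' → ℝ) (m2 : C' → ℝ) (h1 : ∀ r, |m1 r| ≤ 1) (h2 : ∀ c, |m2 c| ≤ 1)
    (h : ∀ r c, M' r c = m1 r * m2 c * M (f r) (g c)) : T q M' ≤ T q M := by
  have e : M' = Matrix.of fun r c => m1 r * (Matrix.of fun c r => m2 c * Mᵀ (g c) r)ᵀ (f r) c := by
    ext r c; simp [h]; ring
  rw [e]
  refine (T_rows hq _ f hf m1 h1).trans ?_
  rw [T_transpose (by linarith)]
  refine (T_rows hq _ g hg m2 h2).trans ?_
  rw [T_transpose (by linarith)]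

lemma T_smul {R C : Type*} [Fintype R] [Fintype C] [DecidableEq C] (q c : ℝ) (A : Matrix R C ℝ) : T q (c • A) = (c ^ 2) ^ q * T q A := by
  unfold T
  have : (c • A)ᵀ * (c • A) = fm (fun u => c ^ 2 * u) (Aᵀ * A) := by
    rw [fm_smul, fm_id (herm_tm A)]; simp [smul_smul, pow_two]
  rw [this, tr_fm_comp (herm_tm A), ← tr_smul_fm]
  congr 2; ext u
  unfold pw
  rw [abs_mul, Real.mul_rpow (abs_nonneg _) (abs_nonneg _), abs_of_nonneg (sq_nonneg c)]

lemma continuous_T {R C : Type*} [Fintype R] [Fintype C] [DecidableEq C] {E : Type*} [TopologicalSpace E] {q : ℝ} (hq : 4 ≤ q) {M : E → Matrix R C ℝ} (hM : Continuous M) :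
    Continuous fun x => T q (M x) := by
  unfold T
  exact (continuous_fm (hM.matrix_transpose.matrix_mul hM) (fun x => herm_tm (M x)) (LL_pw (by linarith))).matrix_trace

end sch
end QR

open MeasureTheory ProbabilityTheory Matrix
open scoped BigOperators ENNReal
namespace QR

variable {J : Type*} [Fintype J] [DecidableEq J]
variable {R C : Type*} [Fintype R] [Fintype C] [DecidableEq R] [DecidableEq C] {ν : J → Measure ℝ} {L : ℝ}

/-- linear form -/
def lr {J R C : Type*} [Fintype J] (B : J → Matrix R C ℝ) (x : J → ℝ) : Matrix R C ℝ := ∑ i, x i • B i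

/-- vertical stack -/
def col {J R C : Type*} (B : J → Matrix R C ℝ) : Matrix (J × R) C ℝ := Matrix.of fun p c => B p.1 p.2 c
/-- horizontal stack -/
def row {J R C : Type*} (B : J → Matrix R C ℝ) : Matrix R (J × C) ℝ := Matrix.of fun r p => B p.1 r p.2

lemma continuous_lr (B : J → Matrix R C ℝ) : Continuous (lr B) := by unfold lr; fun_prop

lemma col_sq (B : J → Matrix R C ℝ) : (col B)ᵀ * col B = ∑ i, (B i)ᵀ * B i := by
  ext c c'
  simp [col, Matrix.mul_apply, Matrix.sum_apply, Fintype.sum_prod_type]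

lemma row_sq (B : J → Matrix R C ℝ) : row B * (row B)ᵀ = ∑ i, B i * (B i)ᵀ := by
  ext c c'
  simp [row, Matrix.mul_apply, Matrix.sum_apply, Fintype.sum_prod_type]

lemma rect_lin (h : Good ν L) (B : J → Matrix R C ℝ) (q : ℝ) (hq : 4 ≤ q) :
    ∫ x, T q (lr B x) ∂(Measure.pi ν) ≤
      (64 * q ^ 2) ^ q * (T q (col B) + T q (row B) + (L ^ 2) ^ q * ∑ i, T q (B i)) := by
  have g := herm_lin h (fun i => hd_herm (B i)) q hq
  have e : ∀ x, lin (fun u => u) (fun i => hd (B i)) x = hd (lr B x) := by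
    intro x
    ext i j
    rcases i with i | i <;> rcases j with j | j <;> simp [hd, lr, lin, Matrix.sum_apply]
  have e2 : ∑ i, hd (B i) * hd (B i) = fromBlocks (row B * (row B)ᵀ) 0 0 ((col B)ᵀ * col B) := by
    rw [col_sq, row_sq]
    simp_rw [hd_sq]
    ext i j
    rcases i with i | i <;> rcases j with j | j <;> simp [Matrix.sum_apply]
  have e3 : (fm (pw q) (row B * (row B)ᵀ)).trace = T q (row B) := by
    rw [← T_transpose (by linarith), T, transpose_transpose]
  simp_rw [e, tr_hd (by linarith : 0 < q)] at g
  rw [integral_const_mul, e2, tr_fm_blocks (by simpa using herm_tm (row B)ᵀ) (herm_tm _), e3, ← Finset.mul_sum] at g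
  change _ ≤ _ * (T q (row B) + T q (col B) + _) at g
  have hK : 0 ≤ (64 * q ^ 2) ^ q := by positivity
  have := mul_nonneg hK (add_nonneg (T_nonneg q (row B)) (T_nonneg q (col B)))
  nlinarith

lemma col_lr (B : J → J → Matrix R C ℝ) (y : J → ℝ) :
    col (fun i => lr (B i) y) = lr (fun j => col fun i => B i j) y := by
  ext p c; simp [col, lr, Matrix.sum_apply]

lemma row_lr (B : J → J → Matrix R C ℝ) (y : J → ℝ) :
    row (fun i => lr (B i) y) = lr (fun j => row fun i => B i j) y := by
  ext p c; simp [row, lr, Matrix.sum_apply]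

/-- bilinear form -/
def bf {J R C : Type*} [Fintype J] (B : J → J → Matrix R C ℝ) (x y : J → ℝ) : Matrix R C ℝ := lr (fun i => lr (B i) y) x

lemma continuous_bf (B : J → J → Matrix R C ℝ) : Continuous fun z : (J → ℝ) × (J → ℝ) => bf B z.1 z.2 := by
  unfold bf lr; fun_prop

lemma chaos (h : Good ν L) (B : J → J → Matrix R C ℝ) (q : ℝ) (hq : 4 ≤ q) :
    ∫ z, T q (bf B z.1 z.2) ∂((Measure.pi ν).prod (Measure.pi ν)) ≤
      ((64 * q ^ 2) ^ q) ^ 2 * (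
        (T q (col fun j => col fun i => B i j) + T q (row fun j => col fun i => B i j) + (L ^ 2) ^ q * ∑ j, T q (col fun i => B i j))
        + (T q (col fun j => row fun i => B i j) + T q (row fun j => row fun i => B i j) + (L ^ 2) ^ q * ∑ j, T q (row fun i => B i j))
        + (L ^ 2) ^ q * ∑ i, (T q (col (B i)) + T q (row (B i)) + (L ^ 2) ^ q * ∑ j, T q (B i j))) := by
  haveI := h.prob
  set K := (64 * q ^ 2) ^ q
  set ℓ := (L ^ 2) ^ q
  have hK : 0 ≤ K := by positivity
  have hℓ : 0 ≤ ℓ := by positivity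
  have c0 : Continuous fun z : (J → ℝ) × (J → ℝ) => T q (bf B z.1 z.2) := continuous_T hq (continuous_bf B)
  rw [integral_prod_symm _ (h.int2 c0)]
  have c1 := continuous_T hq (continuous_lr (fun j => col fun i => B i j))
  have c2 := continuous_T hq (continuous_lr (fun j => row fun i => B i j))
  have c3 := fun i => continuous_T hq (continuous_lr (B i))
  have c4 : Continuous fun y => ℓ * ∑ i, T q (lr (B i) y) := continuous_const.mul (continuous_finset_sum _ fun i _ => c3 i)
  have c12 : Continuous fun y => T q (lr (fun j => col fun i => B i j) y) + T q (lr (fun j => row fun i => B i j) y) := c1.add c2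
  have key : ∫ y, ∫ x, T q (bf B x y) ∂(Measure.pi ν) ∂(Measure.pi ν) ≤
      ∫ y, K * (T q (lr (fun j => col fun i => B i j) y) + T q (lr (fun j => row fun i => B i j) y) + ℓ * ∑ i, T q (lr (B i) y)) ∂(Measure.pi ν) := by
    refine integral_mono (h.int2 c0).integral_prod_right (h.int1 ?_) ?_
    · exact continuous_const.mul ((c1.add c2).add c4)
    intro y
    have := rect_lin h (fun i => lr (B i) y) q hq
    rw [col_lr, row_lr] at this
    exact this
  refine key.trans ?_
  rw [integral_const_mul, integral_add (h.int1 c12) (h.int1 c4), integral_add (h.int1 c1) (h.int1 c2),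
    integral_const_mul, integral_finsetSum _ (fun i _ => h.int1 (c3 i)), pow_two, mul_assoc]
  refine mul_le_mul_of_nonneg_left ?_ hK
  rw [mul_add, mul_add]
  refine add_le_add (add_le_add (rect_lin h _ q hq) (rect_lin h _ q hq)) ?_
  rw [mul_left_comm]
  refine mul_le_mul_of_nonneg_left ?_ hℓ
  rw [Finset.mul_sum]
  exact Finset.sum_le_sum fun i _ => rect_lin h _ q hq

end QR

open MeasureTheory ProbabilityTheory Matrix
open scoped BigOperators ENNReal
namespace QR

variable {n : ℕ} {R C : Type*}

/-- quadratic form -/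
def qf (G : Fin n → Fin n → Matrix R C ℝ) (v : Fin n → ℝ) : Matrix R C ℝ := ∑ i, ∑ j, (v i * v j) • G i j

lemma pd1 (G : Fin n → Fin n → Matrix R C ℝ) (hG : ∀ i j, G i j = G j i) (k : Fin n) :
    pderivAt (qf G) k = fun x => ∑ j, x j • ((2:ℝ) • G k j) := by
  ext x r c
  simp only [pderivAt, Matrix.of_apply, qf, Matrix.sum_apply, Matrix.smul_apply, smul_eq_mul]
  have hd : HasFDerivAt (fun y : Fin n → ℝ => ∑ i, ∑ j, y i * y j * G i j r c)
      (∑ i, ∑ j, (G i j r c) • (x i • ContinuousLinearMap.proj (R := ℝ) (φ := fun _ : Fin n => ℝ) j + x j • ContinuousLinearMap.proj (R := ℝ) (φ := fun _ : Fin n => ℝ) i)) x := by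
    refine HasFDerivAt.fun_sum fun i _ => HasFDerivAt.fun_sum fun j _ => ?_
    exact ((hasFDerivAt_apply i x).mul (hasFDerivAt_apply j x)).mul_const _
  rw [hd.fderiv]
  simp only [ContinuousLinearMap.sum_apply, ContinuousLinearMap.smul_apply, ContinuousLinearMap.add_apply,
    ContinuousLinearMap.proj_apply, smul_eq_mul, Pi.single_apply, mul_ite, mul_one, mul_zero, mul_add,
    Finset.sum_add_distrib, Finset.sum_ite_eq, Finset.sum_ite_eq', Finset.mem_univ, if_true]
  have : ∑ i, ∑ j, (if i = k then G i j r c * x j else 0) = ∑ j, G k j r c * x j := by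
    rw [Finset.sum_eq_single k]
    · simp
    · intro b _ hb; simp [hb]
    · simp
  rw [this, ← Finset.sum_add_distrib]
  refine Finset.sum_congr rfl fun j _ => ?_
  rw [hG j k]; ring

lemma pd2 (H : Fin n → Matrix R C ℝ) (l : Fin n) :
    pderivAt (fun x => ∑ j, x j • H j) l = fun _ => H l := by
  ext x r c
  simp only [pderivAt, Matrix.of_apply, Matrix.sum_apply, Matrix.smul_apply, smul_eq_mul]
  have hd : HasFDerivAt (fun y : Fin n → ℝ => ∑ j, y j * H j r c)
      (∑ j, (H j r c) • ContinuousLinearMap.proj (R := ℝ) (φ := fun _ : Fin n => ℝ) j) x := by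
    refine HasFDerivAt.fun_sum fun i _ => ?_
    exact (hasFDerivAt_apply i x).mul_const _
  rw [hd.fderiv]
  simp [Pi.single_apply]

lemma iter2 (G : Fin n → Fin n → Matrix R C ℝ) (hG : ∀ i j, G i j = G j i) (w : Fin 2 → Fin n) (x : Fin n → ℝ) :
    iterPDeriv (qf G) w x = (2:ℝ) • G (w 0) (w 1) := by
  have : iterPDeriv (qf G) w = pderivAt (pderivAt (qf G) (w 0)) (w 1) := rfl
  rw [this, pd1 G hG, pd2]

section db
variable (G : Fin n → Fin n → Matrix R C ℝ)

lemma db200 (hG : ∀ i j, G i j = G j i) (p q) : derivBlocks (qf G) 2 0 0 0 p q = 2 * G (p.1 0) (p.1 1) p.2.2 q.2.2 := by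
  have e := iter2 G hG (Fin.append (Fin.append p.1 q.1) p.2.1) 0
  have : p.2.1 = q.2.1 := Subsingleton.elim _ _
  simp only [derivBlocks, Matrix.of_apply, if_pos this]
  exact congrFun (congrFun e _) _

lemma db020 (hG : ∀ i j, G i j = G j i) (p q) : derivBlocks (qf G) 0 2 0 0 p q = 2 * G (q.1 0) (q.1 1) p.2.2 q.2.2 := by
  have e := iter2 G hG (Fin.append (Fin.append p.1 q.1) p.2.1) 0
  have : p.2.1 = q.2.1 := Subsingleton.elim _ _
  simp only [derivBlocks, Matrix.of_apply, if_pos this]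
  exact congrFun (congrFun e _) _

lemma db110 (hG : ∀ i j, G i j = G j i) (p q) : derivBlocks (qf G) 1 1 0 0 p q = 2 * G (p.1 0) (q.1 0) p.2.2 q.2.2 := by
  have e := iter2 G hG (Fin.append (Fin.append p.1 q.1) p.2.1) 0
  have : p.2.1 = q.2.1 := Subsingleton.elim _ _
  simp only [derivBlocks, Matrix.of_apply, if_pos this]
  exact congrFun (congrFun e _) _

lemma db101 (hG : ∀ i j, G i j = G j i) (p q) : derivBlocks (qf G) 1 0 1 0 p q = if p.2.1 = q.2.1 then 2 * G (p.1 0) (p.2.1 0) p.2.2 q.2.2 else 0 := by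
  have e := iter2 G hG (Fin.append (Fin.append p.1 q.1) p.2.1) 0
  simp only [derivBlocks, Matrix.of_apply]
  split_ifs
  · exact congrFun (congrFun e _) _
  · rfl

lemma db011 (hG : ∀ i j, G i j = G j i) (p q) : derivBlocks (qf G) 0 1 1 0 p q = if p.2.1 = q.2.1 then 2 * G (q.1 0) (p.2.1 0) p.2.2 q.2.2 else 0 := by
  have e := iter2 G hG (Fin.append (Fin.append p.1 q.1) p.2.1) 0
  simp only [derivBlocks, Matrix.of_apply]
  split_ifs
  · exact congrFun (congrFun e _) _
  · rfl

lemma db002 (hG : ∀ i j, G i j = G j i) (p q) : derivBlocks (qf G) 0 0 2 0 p q = if p.2.1 = q.2.1 then 2 * G (p.2.1 0) (p.2.1 1) p.2.2 q.2.2 else 0 := by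
  have e := iter2 G hG (Fin.append (Fin.append p.1 q.1) p.2.1) 0
  simp only [derivBlocks, Matrix.of_apply]
  split_ifs
  · exact congrFun (congrFun e _) _
  · rfl
end db

end QR

open MeasureTheory ProbabilityTheory Matrix
open scoped BigOperators ENNReal
namespace QR

variable {n : ℕ} {R C : Type*} [Fintype R] [Fintype C] [DecidableEq R] [DecidableEq C]

lemma b2_inj {α β : Type*} : Function.Injective fun p : α × α × β => ((![p.2.1, p.1] : Fin 2 → α), (Fin.elim0 : Fin 0 → α), p.2.2) := by
  rintro ⟨a, b, c⟩ ⟨a', b', c'⟩ h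
  simp only [Prod.mk.injEq] at h
  have h0 := congrFun h.1 0
  have h1 := congrFun h.1 1
  simp at h0 h1
  simp [h0, h1, h.2.2]

lemma b0_inj {α β : Type*} : Function.Injective fun c : β => ((Fin.elim0 : Fin 0 → α), (Fin.elim0 : Fin 0 → α), c) := by
  intro a b h
  simpa using h

lemma b1_inj {α β : Type*} : Function.Injective fun p : α × β => ((fun _ => p.1 : Fin 1 → α), (Fin.elim0 : Fin 0 → α), p.2) := by
  rintro ⟨a, b⟩ ⟨a', b'⟩ h
  simp only [Prod.mk.injEq] at h
  have h0 := congrFun h.1 0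
  simp [h0, h.2.2]

lemma b11_inj {α β : Type*} : Function.Injective fun p : (α × β) × α => ((fun _ => p.1.1 : Fin 1 → α), (fun _ => p.2 : Fin 1 → α), p.1.2) := by
  rintro ⟨⟨a, b⟩, c⟩ ⟨⟨a', b'⟩, c'⟩ h
  simp only [Prod.mk.injEq] at h
  have h0 := congrFun h.1 0
  have h1 := congrFun h.2.1 0
  simp [h0, h1, h.2.2]

lemma b01_inj {α β : Type*} : Function.Injective fun p : β × α => ((Fin.elim0 : Fin 0 → α), (fun _ => p.2 : Fin 1 → α), p.1) := by
  rintro ⟨b, c⟩ ⟨b', c'⟩ h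
  simp only [Prod.mk.injEq] at h
  have h1 := congrFun h.2.1 0
  simp [h1, h.2.2]

lemma b02_inj {α β : Type*} : Function.Injective fun p : β × (α × α) => ((Fin.elim0 : Fin 0 → α), (![p.2.1, p.2.2] : Fin 2 → α), p.1) := by
  rintro ⟨b, c, d⟩ ⟨b', c', d'⟩ h
  simp only [Prod.mk.injEq] at h
  have h0 := congrFun h.2.1 0
  have h1 := congrFun h.2.1 1
  simp at h0 h1
  simp [h0, h1, h.2.2]

/-- masked coefficients -/
noncomputable def mk (G : Fin n → Fin n → Matrix R C ℝ) (a b : Fin n → ℝ) (i j : Fin n) : Matrix R C ℝ :=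
  (a i * b j * 2) • G i j

variable (G : Fin n → Fin n → Matrix R C ℝ) (q : ℝ) (a b : Fin n → ℝ)

lemma abs_mul_le {x y : ℝ} (hx : |x| ≤ 1) (hy : |y| ≤ 1) : |x * y| ≤ 1 := by
  rw [abs_mul]; exact mul_le_one₀ hx (abs_nonneg _) hy

lemma m1 (hG : ∀ i j, G i j = G j i) (hq : 4 ≤ q) (ha : ∀ i, |a i| ≤ 1) (hb : ∀ i, |b i| ≤ 1) :
    T q (col fun j => col fun i => mk G a b i j) ≤ T q (derivBlocks (qf G) 2 0 0 0) := by
  refine T_contr hq _ _ _ _ b2_inj b0_inj (fun p => a p.2.1 * b p.1) (fun _ => 1) (fun r => abs_mul_le (ha _) (hb _)) (by simp) ?_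
  intro r c
  rw [db200 G hG]
  simp [col, mk]; ring

lemma m5 (hG : ∀ i j, G i j = G j i) (hq : 4 ≤ q) (ha : ∀ i, |a i| ≤ 1) (hb : ∀ i, |b i| ≤ 1) :
    T q (row fun j => row fun i => mk G a b i j) ≤ T q (derivBlocks (qf G) 0 2 0 0) := by
  refine T_contr hq _ _ _ _ b0_inj b2_inj (fun _ => 1) (fun p => a p.2.1 * b p.1) (by simp) (fun r => abs_mul_le (ha _) (hb _)) ?_
  intro r c
  rw [db020 G hG]
  simp [row, mk]; ring

lemma m2 (hG : ∀ i j, G i j = G j i) (hq : 4 ≤ q) (ha : ∀ i, |a i| ≤ 1) (hb : ∀ i, |b i| ≤ 1) :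
    T q (row fun j => col fun i => mk G a b i j) ≤ T q (derivBlocks (qf G) 1 1 0 0) := by
  refine T_contr hq _ _ _ _ b1_inj b1_inj (fun p => a p.1) (fun p => b p.1) (fun r => ha _) (fun r => hb _) ?_
  intro r c
  rw [db110 G hG]
  simp [row, col, mk]; ring

lemma m4 (hG : ∀ i j, G i j = G j i) (hq : 4 ≤ q) (ha : ∀ i, |a i| ≤ 1) (hb : ∀ i, |b i| ≤ 1) :
    T q (col fun j => row fun i => mk G a b i j) ≤ T q (derivBlocks (qf G) 1 1 0 0) := by
  refine T_contr hq _ _ _ _ b1_inj b1_inj (fun p => b p.1) (fun p => a p.1) (fun r => hb _) (fun r => ha _) ?_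
  intro r c
  rw [db110 G hG, hG]
  simp [row, col, mk]; ring

lemma m3 (hG : ∀ i j, G i j = G j i) (hq : 4 ≤ q) (ha : ∀ i, |a i| ≤ 1) (hb : ∀ i, |b i| ≤ 1) :
    ∑ j, T q (col fun i => mk G a b i j) ≤ T q (derivBlocks (qf G) 1 0 1 0) := by
  rw [← T_blockDiagonal]
  refine T_contr hq _ _ _ _ b11_inj b01_inj (fun p => a p.1.1 * b p.2) (fun _ => 1) (fun r => abs_mul_le (ha _) (hb _)) (by simp) ?_
  intro r c
  rw [db101 G hG, blockDiagonal_apply]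
  by_cases h : r.2 = c.2
  · simp [col, mk, h]; ring
  · simp [h, funext_iff]

lemma m7 (hG : ∀ i j, G i j = G j i) (hq : 4 ≤ q) (ha : ∀ i, |a i| ≤ 1) (hb : ∀ i, |b i| ≤ 1) :
    ∑ i, T q (col fun j => mk G a b i j) ≤ T q (derivBlocks (qf G) 1 0 1 0) := by
  rw [← T_blockDiagonal]
  refine T_contr hq _ _ _ _ b11_inj b01_inj (fun p => a p.2 * b p.1.1) (fun _ => 1) (fun r => abs_mul_le (ha _) (hb _)) (by simp) ?_
  intro r c
  rw [db101 G hG, blockDiagonal_apply]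
  by_cases h : r.2 = c.2
  · simp [col, mk, h, hG r.1.1 c.2]; ring
  · simp [h, funext_iff]

lemma m6 (hG : ∀ i j, G i j = G j i) (hq : 4 ≤ q) (ha : ∀ i, |a i| ≤ 1) (hb : ∀ i, |b i| ≤ 1) :
    ∑ j, T q (row fun i => mk G a b i j) ≤ T q (derivBlocks (qf G) 0 1 1 0) := by
  rw [← T_blockDiagonal]
  refine T_contr hq _ _ _ _ b01_inj b11_inj (fun _ => 1) (fun p => a p.1.1 * b p.2) (by simp) (fun r => abs_mul_le (ha _) (hb _)) ?_
  intro r c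
  rw [db011 G hG, blockDiagonal_apply]
  by_cases h : r.2 = c.2
  · simp [row, mk, h]; ring
  · simp [h, funext_iff]

lemma m8 (hG : ∀ i j, G i j = G j i) (hq : 4 ≤ q) (ha : ∀ i, |a i| ≤ 1) (hb : ∀ i, |b i| ≤ 1) :
    ∑ i, T q (row fun j => mk G a b i j) ≤ T q (derivBlocks (qf G) 0 1 1 0) := by
  rw [← T_blockDiagonal]
  refine T_contr hq _ _ _ _ b01_inj b11_inj (fun _ => 1) (fun p => a p.2 * b p.1.1) (by simp) (fun r => abs_mul_le (ha _) (hb _)) ?_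
  intro r c
  rw [db011 G hG, blockDiagonal_apply]
  by_cases h : r.2 = c.2
  · simp [row, mk, h, hG c.1.1 c.2]; ring
  · simp [h, funext_iff]

lemma m9 (hG : ∀ i j, G i j = G j i) (hq : 4 ≤ q) (ha : ∀ i, |a i| ≤ 1) (hb : ∀ i, |b i| ≤ 1) :
    ∑ i, ∑ j, T q (mk G a b i j) ≤ T q (derivBlocks (qf G) 0 0 2 0) := by
  rw [← Fintype.sum_prod_type' (f := fun i j => T q (mk G a b i j)), ← T_blockDiagonal]
  refine T_contr hq _ _ _ _ b02_inj b02_inj (fun p => a p.2.1 * b p.2.2) (fun _ => 1) (fun r => abs_mul_le (ha _) (hb _)) (by simp) ?_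
  intro r c
  rw [db002 G hG, blockDiagonal_apply]
  by_cases h : r.2 = c.2
  · simp [mk, h]; ring
  · have : ¬ ((![r.2.1, r.2.2] : Fin 2 → Fin n) = ![c.2.1, c.2.2]) := by
      intro h'
      have h0 := congrFun h' 0
      have h1 := congrFun h' 1
      simp at h0 h1
      exact h (Prod.ext h0 h1)
    rw [if_neg h, if_neg this]; simp

/-- right-hand side -/
noncomputable def rhs (G : Fin n → Fin n → Matrix R C ℝ) (q ℓ : ℝ) : ℝ :=
  T q (derivBlocks (qf G) 2 0 0 0) + T q (derivBlocks (qf G) 0 2 0 0) + T q (derivBlocks (qf G) 1 1 0 0)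
   + ℓ * T q (derivBlocks (qf G) 1 0 1 0) + ℓ * T q (derivBlocks (qf G) 0 1 1 0) + ℓ ^ 2 * T q (derivBlocks (qf G) 0 0 2 0)

variable {ν : Fin n → Measure ℝ} {L : ℝ}

lemma chaos_mask (h : Good ν L) (hG : ∀ i j, G i j = G j i) (hq : 4 ≤ q) (ha : ∀ i, |a i| ≤ 1) (hb : ∀ i, |b i| ≤ 1) :
    ∫ z, T q (bf (mk G a b) z.1 z.2) ∂((Measure.pi ν).prod (Measure.pi ν)) ≤
      2 * ((64 * q ^ 2) ^ q) ^ 2 * rhs G q ((L ^ 2) ^ q) := by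
  refine (chaos h (mk G a b) q hq).trans ?_
  set K := (64 * q ^ 2) ^ q
  set ℓ := (L ^ 2) ^ q with hℓd
  have hℓ : 0 ≤ ℓ := by positivity
  rw [mul_comm 2, mul_assoc]
  refine mul_le_mul_of_nonneg_left ?_ (sq_nonneg K)
  simp only [Finset.sum_add_distrib, ← Finset.mul_sum, rhs]
  have h1 := m1 G q a b hG hq ha hb
  have h2 := m2 G q a b hG hq ha hb
  have h4 := m4 G q a b hG hq ha hb
  have h5 := m5 G q a b hG hq ha hb
  have h3 := mul_le_mul_of_nonneg_left (m3 G q a b hG hq ha hb) hℓ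
  have h6 := mul_le_mul_of_nonneg_left (m6 G q a b hG hq ha hb) hℓ
  have h7 := mul_le_mul_of_nonneg_left (m7 G q a b hG hq ha hb) hℓ
  have h8 := mul_le_mul_of_nonneg_left (m8 G q a b hG hq ha hb) hℓ
  have h9 := mul_le_mul_of_nonneg_left (m9 G q a b hG hq ha hb) (sq_nonneg ℓ)
  have p1 := T_nonneg q (derivBlocks (qf G) 2 0 0 0)
  have p2 := T_nonneg q (derivBlocks (qf G) 0 2 0 0)
  have p3 := mul_nonneg (sq_nonneg ℓ) (T_nonneg q (derivBlocks (qf G) 0 0 2 0))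
  linarith

end QR

open MeasureTheory ProbabilityTheory Matrix
open scoped BigOperators ENNReal
namespace QR

variable {n : ℕ} {R C : Type*} [Fintype R] [Fintype C] [DecidableEq R] [DecidableEq C]
variable {ν : Fin n → Measure ℝ} {L : ℝ}

/-- indicator -/
def ia (S : Finset (Fin n)) (i : Fin n) : ℝ := if i ∈ S then 1 else 0
/-- complementary indicator -/
def ib (S : Finset (Fin n)) (i : Fin n) : ℝ := if i ∈ S then 0 else 1

lemma bf_mk (G : Fin n → Fin n → Matrix R C ℝ) (a b : Fin n → ℝ) (x y : Fin n → ℝ) :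
    bf (mk G a b) x y = ∑ i, ∑ j, ((a i * x i) * (b j * y j) * 2) • G i j := by
  unfold bf lr mk
  refine Finset.sum_congr rfl fun i _ => ?_
  rw [Finset.smul_sum]
  refine Finset.sum_congr rfl fun j _ => ?_
  rw [smul_smul, smul_smul]; congr 1; ring

lemma dec1 (h : Good ν L) (G : Fin n → Fin n → Matrix R C ℝ) (S : Finset (Fin n)) (q : ℝ) (hq : 4 ≤ q) :
    ∫ x, T q (bf (mk G (ia S) (ib S)) x x) ∂(Measure.pi ν) =
    ∫ z, T q (bf (mk G (ia S) (ib S)) z.1 z.2) ∂((Measure.pi ν).prod (Measure.pi ν)) := by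
  haveI := h.prob
  rw [← int_fst (ν := ν)]
  have c : Continuous fun z : (Fin n → ℝ) × (Fin n → ℝ) => T q (bf (mk G (ia S) (ib S)) z.1 z.1) := by
    refine continuous_T hq ?_
    unfold bf lr; fun_prop
  rw [← int_sw Sᶜ c]
  congr 1; ext z
  congr 1
  rw [bf_mk, bf_mk]
  refine Finset.sum_congr rfl fun i _ => Finset.sum_congr rfl fun j _ => ?_
  have e1 : ia S i * (sw Sᶜ z).1 i = ia S i * z.1 i := by
    by_cases hi : i ∈ S <;> simp [ia, sw, hi]
  have e2 : ib S j * (sw Sᶜ z).1 j = ib S j * z.2 j := by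
    by_cases hi : j ∈ S <;> simp [ib, sw, hi]
  rw [e1, e2]

lemma sum_flip (i : Fin n) (g : Finset (Fin n) → ℝ) (hg : ∀ S, g (symmDiff S {i}) = - g S) : ∑ S, g S = 0 := by
  have hinv : Function.Involutive fun S : Finset (Fin n) => symmDiff S {i} := fun S => by simp
  have := Equiv.sum_comp hinv.toPerm g
  simp only [Function.Involutive.coe_toPerm, hg, Finset.sum_neg_distrib] at this
  linarith

lemma sum_ab {i j : Fin n} (hij : i ≠ j) : ∑ S : Finset (Fin n), ia S i * ib S j * 4 = 2 ^ n := by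
  have e : ∀ S : Finset (Fin n), ia S i * ib S j * 4 = 1 + (if i ∈ S then 1 else -1) - (if j ∈ S then 1 else -1)
     - (if i ∈ S then 1 else -1) * (if j ∈ S then 1 else -1) := by
    intro S
    unfold ia ib
    split_ifs <;> norm_num
  simp_rw [e]
  rw [Finset.sum_sub_distrib, Finset.sum_sub_distrib, Finset.sum_add_distrib]
  have h1 : ∀ (k : Fin n) (S : Finset (Fin n)), k ∈ symmDiff S {k} ↔ k ∉ S := by
    intro k S; simp [Finset.mem_symmDiff]
  have h2 : ∀ (S : Finset (Fin n)), j ∈ symmDiff S {i} ↔ j ∈ S := by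
    intro S; simp [Finset.mem_symmDiff, hij.symm]
  have f1 : ∀ k : Fin n, ∑ S : Finset (Fin n), (if k ∈ S then (1:ℝ) else -1) = 0 := by
    intro k
    refine sum_flip k (fun S => if k ∈ S then (1:ℝ) else -1) fun S => ?_
    simp only [h1]
    by_cases hk : k ∈ S <;> simp [hk]
  have f3 : ∑ S : Finset (Fin n), (if i ∈ S then (1:ℝ) else -1) * (if j ∈ S then (1:ℝ) else -1) = 0 := by
    refine sum_flip i (fun S => (if i ∈ S then (1:ℝ) else -1) * (if j ∈ S then (1:ℝ) else -1)) fun S => ?_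
    simp only [h1, h2]
    by_cases hk : i ∈ S <;> by_cases hj : j ∈ S <;> simp [hk, hj]
  rw [f1, f1, f3]
  simp

lemma avg (G : Fin n → Fin n → Matrix R C ℝ) (h0 : ∀ i, G i i = 0) (x : Fin n → ℝ) :
    qf G x = ∑ S : Finset (Fin n), ((2:ℝ) ^ n)⁻¹ • ((2:ℝ) • bf (mk G (ia S) (ib S)) x x) := by
  simp_rw [bf_mk, Finset.smul_sum, smul_smul]
  rw [Finset.sum_comm]
  unfold qf
  refine Finset.sum_congr rfl fun i _ => ?_
  rw [Finset.sum_comm]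
  refine Finset.sum_congr rfl fun j _ => ?_
  rw [← Finset.sum_smul]
  by_cases hij : i = j
  · subst hij; simp [h0]
  congr 1
  have : ∀ S : Finset (Fin n), ((2:ℝ) ^ n)⁻¹ * (2 * ((ia S i * x i) * (ib S j * x j) * 2)) = ((2:ℝ) ^ n)⁻¹ * (x i * x j) * (ia S i * ib S j * 4) := by
    intro S; ring
  simp_rw [this]
  rw [← Finset.mul_sum, sum_ab hij]
  field_simp

lemma decouple (h : Good ν L) (G : Fin n → Fin n → Matrix R C ℝ) (hG : ∀ i j, G i j = G j i) (h0 : ∀ i, G i i = 0) (q : ℝ) (hq : 4 ≤ q) :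
    ∫ x, T q (qf G x) ∂(Measure.pi ν) ≤ 4 ^ q * (2 * ((64 * q ^ 2) ^ q) ^ 2 * rhs G q ((L ^ 2) ^ q)) := by
  haveI := h.prob
  have cb : ∀ S : Finset (Fin n), Continuous fun x => T q (bf (mk G (ia S) (ib S)) x x) := by
    intro S
    refine continuous_T hq ?_
    unfold bf lr; fun_prop
  have cq : Continuous fun x => T q (qf G x) := by
    refine continuous_T hq ?_
    unfold qf; fun_prop
  have hc : ∑ S : Finset (Fin n), ((2:ℝ) ^ n)⁻¹ = 1 := by simp
  have cs : ∀ S : Finset (Fin n), Continuous fun x => ((2:ℝ) ^ n)⁻¹ * (4 ^ q * T q (bf (mk G (ia S) (ib S)) x x)) :=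
    fun S => continuous_const.mul (continuous_const.mul (cb S))
  calc ∫ x, T q (qf G x) ∂(Measure.pi ν) ≤ ∫ x, ∑ S : Finset (Fin n), ((2:ℝ) ^ n)⁻¹ * (4 ^ q * T q (bf (mk G (ia S) (ib S)) x x)) ∂(Measure.pi ν) := by
        refine integral_mono (h.int1 cq) (h.int1 (continuous_finset_sum _ fun S _ => cs S)) ?_
        intro x
        simp only
        rw [avg G h0]
        refine (T_conv hq _ (fun _ => by positivity) hc _).trans (le_of_eq ?_)
        refine Finset.sum_congr rfl fun S _ => ?_
        rw [T_smul]; norm_num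
    _ = ∑ S : Finset (Fin n), ((2:ℝ) ^ n)⁻¹ * (4 ^ q * ∫ x, T q (bf (mk G (ia S) (ib S)) x x) ∂(Measure.pi ν)) := by
        rw [integral_finsetSum _ (fun S _ => h.int1 (cs S))]
        refine Finset.sum_congr rfl fun S _ => ?_
        rw [integral_const_mul, integral_const_mul]
    _ ≤ ∑ S : Finset (Fin n), ((2:ℝ) ^ n)⁻¹ * (4 ^ q * (2 * ((64 * q ^ 2) ^ q) ^ 2 * rhs G q ((L ^ 2) ^ q))) := by
        refine Finset.sum_le_sum fun S _ => ?_
        rw [dec1 h G S q hq]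
        refine mul_le_mul_of_nonneg_left (mul_le_mul_of_nonneg_left (chaos_mask G q _ _ h hG hq ?_ ?_) (by positivity)) (by positivity)
        · intro i; unfold ia; split_ifs <;> simp
        · intro i; unfold ib; split_ifs <;> simp
    _ = _ := by rw [← Finset.sum_mul, hc, one_mul]

/-- right-hand side with norms -/
noncomputable def rhsN (G : Fin n → Fin n → Matrix R C ℝ) (q L : ℝ) : ℝ :=
  schattenNorm q (derivBlocks (qf G) 2 0 0 0) + schattenNorm q (derivBlocks (qf G) 0 2 0 0) + schattenNorm q (derivBlocks (qf G) 1 1 0 0)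
   + L * schattenNorm q (derivBlocks (qf G) 1 0 1 0) + L * schattenNorm q (derivBlocks (qf G) 0 1 1 0) + L ^ 2 * schattenNorm q (derivBlocks (qf G) 0 0 2 0)

lemma sN_nonneg {R C : Type*} [Fintype R] [Fintype C] [DecidableEq C] (q : ℝ) (A : Matrix R C ℝ) : 0 ≤ schattenNorm q A := by
  unfold schattenNorm; rw [T_eq]; exact Real.rpow_nonneg (T_nonneg _ _) _

lemma sN_pow {R C : Type*} [Fintype R] [Fintype C] [DecidableEq C] {q : ℝ} (hq : 0 < q) (A : Matrix R C ℝ) : T q A = schattenNorm q A ^ (2 * q) := by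
  unfold schattenNorm
  rw [T_eq, Real.rpow_inv_rpow (T_nonneg _ _) (by positivity)]

lemma rhs_le (G : Fin n → Fin n → Matrix R C ℝ) (q : ℝ) (hq : 4 ≤ q) (hL : 0 ≤ L) : rhs G q ((L ^ 2) ^ q) ≤ rhsN G q L ^ (2 * q) := by
  unfold rhs rhsN
  simp only [sN_pow (by linarith : 0 < q)]
  have s : ∀ x y : ℝ, 0 ≤ x → 0 ≤ y → x ^ (2 * q) + y ^ (2 * q) ≤ (x + y) ^ (2 * q) := 
    fun x y hx hy => Real.add_rpow_le_rpow_add hx hy (by linarith)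
  have e1 : (L ^ 2) ^ q = L ^ (2 * q) := by rw [Real.rpow_mul hL]; norm_num
  have e2 : ∀ y, 0 ≤ y → (L ^ 2) ^ q * y ^ (2 * q) = (L * y) ^ (2 * q) := by
    intro y hy; rw [e1, Real.mul_rpow hL hy]
  have e3 : ∀ y, 0 ≤ y → ((L ^ 2) ^ q) ^ 2 * y ^ (2 * q) = (L ^ 2 * y) ^ (2 * q) := by
    intro y hy; rw [Real.mul_rpow (by positivity) hy, pow_two ((L ^ 2) ^ q), ← Real.rpow_add' (by positivity) (by linarith)]; congr 2; ring
  rw [e2 _ (sN_nonneg _ _), e2 _ (sN_nonneg _ _), e3 _ (sN_nonneg _ _)]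
  have n1 := sN_nonneg q (derivBlocks (qf G) 2 0 0 0)
  have n2 := sN_nonneg q (derivBlocks (qf G) 0 2 0 0)
  have n3 := sN_nonneg q (derivBlocks (qf G) 1 1 0 0)
  have n4 := mul_nonneg hL (sN_nonneg q (derivBlocks (qf G) 1 0 1 0))
  have n5 := mul_nonneg hL (sN_nonneg q (derivBlocks (qf G) 0 1 1 0))
  have n6 := mul_nonneg (sq_nonneg L) (sN_nonneg q (derivBlocks (qf G) 0 0 2 0))
  have s1 := s _ _ n1 n2
  have s2 := s _ _ (add_nonneg n1 n2) n3
  have s3 := s _ _ (add_nonneg (add_nonneg n1 n2) n3) n4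
  have s4 := s _ _ (add_nonneg (add_nonneg (add_nonneg n1 n2) n3) n4) n5
  have s5 := s _ _ (add_nonneg (add_nonneg (add_nonneg (add_nonneg n1 n2) n3) n4) n5) n6
  linarith

lemma main_norm (h : Good ν L) (G : Fin n → Fin n → Matrix R C ℝ) (hG : ∀ i j, G i j = G j i) (h0 : ∀ i, G i i = 0) (q : ℝ) (hq : 4 ≤ q) :
    ∫ x, schattenNorm q (qf G x) ∂(Measure.pi ν) ≤ 256 * q ^ 2 * rhsN G q L := by
  haveI := h.prob
  have hL : 0 ≤ L := by linarith [h.one_le]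
  have hr : 0 ≤ rhsN G q L := by
    unfold rhsN
    have n1 := sN_nonneg q (derivBlocks (qf G) 2 0 0 0)
    have n2 := sN_nonneg q (derivBlocks (qf G) 0 2 0 0)
    have n3 := sN_nonneg q (derivBlocks (qf G) 1 1 0 0)
    have n4 := mul_nonneg hL (sN_nonneg q (derivBlocks (qf G) 1 0 1 0))
    have n5 := mul_nonneg hL (sN_nonneg q (derivBlocks (qf G) 0 1 1 0))
    have n6 := mul_nonneg (sq_nonneg L) (sN_nonneg q (derivBlocks (qf G) 0 0 2 0))
    linarith
  have cq : Continuous fun x => T q (qf G x) := by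
    refine continuous_T hq ?_
    unfold qf; fun_prop
  have cN : Continuous fun x => schattenNorm q (qf G x) := by
    unfold schattenNorm
    simp only [T_eq]
    exact cq.rpow_const fun x => Or.inr (by positivity)
  have d := decouple h G hG h0 q hq
  have d2 : ∫ x, T q (qf G x) ∂(Measure.pi ν) ≤ (256 * q ^ 2 * rhsN G q L) ^ (2 * q) := by
    refine d.trans ?_
    have r := rhs_le (L := L) G q hq hL
    rw [Real.mul_rpow (by positivity) hr]
    have k : (4:ℝ) ^ q * (2 * ((64 * q ^ 2) ^ q) ^ 2) ≤ (256 * q ^ 2) ^ (2 * q) := by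
      have k1 : (256 * q ^ 2) ^ (2 * q) = (4:ℝ) ^ q * (4 ^ q * ((64 * q ^ 2) ^ q) ^ 2) := by
        have e1 : ((64 * q ^ 2) ^ q) ^ 2 = (64 * q ^ 2) ^ (2 * q) := by
          rw [mul_comm 2 q, Real.rpow_mul (by positivity)]; norm_num
        have e2 : (4:ℝ) ^ (2 * q) = 4 ^ q * 4 ^ q := by
          rw [← Real.rpow_add (by norm_num)]; congr 1; ring
        rw [← mul_assoc, ← e2, e1, ← Real.mul_rpow (by norm_num) (by positivity)]
        congr 1; ring
      rw [k1]
      have k2 : (2:ℝ) ≤ 4 ^ q := by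
        calc (2:ℝ) ≤ 4 ^ (1:ℝ) := by norm_num
          _ ≤ 4 ^ q := Real.rpow_le_rpow_of_exponent_le (by norm_num) (by linarith)
      gcongr
    calc _ = (4:ℝ) ^ q * (2 * ((64 * q ^ 2) ^ q) ^ 2) * rhs G q ((L ^ 2) ^ q) := by ring
      _ ≤ (4:ℝ) ^ q * (2 * ((64 * q ^ 2) ^ q) ^ 2) * rhsN G q L ^ (2 * q) := by gcongr
      _ ≤ _ := by gcongr
  have jen : (∫ x, schattenNorm q (qf G x) ∂(Measure.pi ν)) ^ (2 * q) ≤ ∫ x, T q (qf G x) ∂(Measure.pi ν) := by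
    have hconv : ConvexOn ℝ (Set.Ici 0) fun x : ℝ => x ^ (2 * q) := convexOn_rpow (by linarith)
    have := hconv.map_integral_le (μ := Measure.pi ν) (f := fun x => schattenNorm q (qf G x))
      ((Real.continuous_rpow_const (by linarith)).continuousOn) isClosed_Ici
      (Filter.Eventually.of_forall fun x => sN_nonneg _ _) (h.int1 cN) ?_
    · simp_rw [sN_pow (by linarith : 0 < q)]
      exact this
    · refine h.int1 ?_
      exact cN.rpow_const fun x => Or.inr (by linarith)
  exact (Real.rpow_le_rpow_iff (integral_nonneg fun x => sN_nonneg _ _) (by positivity) (by linarith : 0 < 2 * q)).1 (jen.trans d2)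

end QR

open MeasureTheory ProbabilityTheory Matrix
open scoped BigOperators ENNReal
namespace QR

lemma sN_zero {R C : Type*} [Fintype R] [Fintype C] [DecidableEq C] {q : ℝ} (hq : 0 < q) (M : Matrix R C ℝ) (hM : M = 0) :
    schattenNorm q M = 0 := by
  have h := T_smul q 0 M
  subst hM
  unfold schattenNorm
  rw [T_eq]
  rw [smul_zero] at h
  rw [h]
  have : ((0:ℝ) ^ 2) ^ q = 0 := by rw [zero_pow (by norm_num), Real.zero_rpow hq.ne']
  rw [this, zero_mul, Real.zero_rpow (by positivity)]

lemma rhsN_zero {R C : Type*} [Fintype R] [Fintype C] [DecidableEq R] [DecidableEq C]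
    (G : Fin 0 → Fin 0 → Matrix R C ℝ) (q L : ℝ) (hq : 0 < q) : rhsN G q L = 0 := by
  have key : ∀ a b c, a + b + c = 2 → schattenNorm q (derivBlocks (qf G) a b c 0) = 0 := by
    intro a b c h
    refine sN_zero hq _ ?_
    ext p r
    exact ((Fin.append (Fin.append p.1 r.1) p.2.1) ⟨0, by omega⟩).elim0
  unfold rhsN
  rw [key _ _ _ rfl, key _ _ _ rfl, key _ _ _ rfl, key _ _ _ rfl, key _ _ _ rfl, key _ _ _ rfl]
  simp

lemma rhsN_nonneg {n : ℕ} {R C : Type*} [Fintype R] [Fintype C] [DecidableEq R] [DecidableEq C]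
    (G : Fin n → Fin n → Matrix R C ℝ) (q L : ℝ) (hL : 0 ≤ L) : 0 ≤ rhsN G q L := by
  unfold rhsN
  have n1 := sN_nonneg q (derivBlocks (qf G) 2 0 0 0)
  have n2 := sN_nonneg q (derivBlocks (qf G) 0 2 0 0)
  have n3 := sN_nonneg q (derivBlocks (qf G) 1 1 0 0)
  have n4 := mul_nonneg hL (sN_nonneg q (derivBlocks (qf G) 1 0 1 0))
  have n5 := mul_nonneg hL (sN_nonneg q (derivBlocks (qf G) 0 1 1 0))
  have n6 := mul_nonneg (sq_nonneg L) (sN_nonneg q (derivBlocks (qf G) 0 0 2 0))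
  linarith

lemma cont_sN {n : ℕ} {R C : Type*} [Fintype R] [Fintype C] [DecidableEq R] [DecidableEq C]
    (G : Fin n → Fin n → Matrix R C ℝ) (q : ℝ) (hq : 4 ≤ q) : Continuous fun x => schattenNorm q (qf G x) := by
  have cq : Continuous fun x => T q (qf G x) := by
    refine continuous_T hq ?_
    unfold qf; fun_prop
  unfold schattenNorm
  simp only [T_eq]
  exact cq.rpow_const fun x => Or.inr (by positivity)

lemma good_of {Ω : Type*} [MeasurableSpace Ω] (μ : Measure Ω) [IsProbabilityMeasure μ]
    {n : ℕ} (hn : 0 < n) (x : Fin n → Ω → ℝ) (L : ℝ)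
    (hmeas : ∀ i, Measurable (x i))
    (hmean : ∀ i, ∫ ω, x i ω ∂μ = 0)
    (hvar : ∀ i, ∫ ω, (x i ω) ^ 2 ∂μ = 1)
    (hbdd : ∀ i, ∀ᵐ ω ∂μ, |x i ω| ≤ L) : Good (fun i => μ.map (x i)) L where
  prob i := Measure.isProbabilityMeasure_map (hmeas i).aemeasurable
  mean i := by
    rw [integral_map (hmeas i).aemeasurable (by fun_prop)]; exact hmean i
  var i := by
    rw [integral_map (hmeas i).aemeasurable (by fun_prop)]; exact hvar i
  bdd i := by
    rw [ae_map_iff (hmeas i).aemeasurable (measurableSet_le (by fun_prop) (by fun_prop))]; exact hbdd i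
  one_le := by
    let i : Fin n := ⟨0, hn⟩
    have hL : 0 ≤ L := by
      obtain ⟨ω, hω⟩ := (hbdd i).exists
      exact (abs_nonneg _).trans hω
    have h1 : ∫ ω, (x i ω) ^ 2 ∂μ ≤ ∫ ω, L ^ 2 ∂μ := by
      refine integral_mono_ae ?_ (integrable_const _) ?_
      · by_contra hc
        have := integral_undef hc
        rw [hvar i] at this
        norm_num at this
      · filter_upwards [hbdd i] with ω hω
        exact sq_le_sq' (abs_le.1 hω).1 (abs_le.1 hω).2
    rw [hvar i] at h1
    simp at h1
    rwa [abs_of_nonneg hL] at h1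

lemma matInt_zero {Ω : Type*} [MeasurableSpace Ω] (μ : Measure Ω) [IsProbabilityMeasure μ]
    {n : ℕ} {R C : Type*} [Fintype R] [Fintype C] (x : Fin n → Ω → ℝ) (L : ℝ)
    (hmeas : ∀ i, Measurable (x i))
    (hindep : iIndepFun x μ)
    (hmean : ∀ i, ∫ ω, x i ω ∂μ = 0)
    (hbdd : ∀ i, ∀ᵐ ω ∂μ, |x i ω| ≤ L) (G : Fin n → Fin n → Matrix R C ℝ) (h0 : ∀ i, G i i = 0) :
    matIntegral μ (fun ω => qf G fun i => x i ω) = 0 := by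
  ext r c
  simp only [matIntegral, Matrix.of_apply, qf, Matrix.sum_apply, Matrix.smul_apply, Matrix.zero_apply, smul_eq_mul]
  have hi : ∀ i j, Integrable (fun ω => x i ω * x j ω * G i j r c) μ := by
    intro i j
    refine Integrable.mul_const ?_ _
    refine Integrable.of_bound ((hmeas i).mul (hmeas j)).aestronglyMeasurable (L * L) ?_
    filter_upwards [hbdd i, hbdd j] with ω h1 h2
    rw [Real.norm_eq_abs, abs_mul]
    exact mul_le_mul h1 h2 (abs_nonneg _) ((abs_nonneg _).trans h1)
  rw [integral_finsetSum _ (fun i _ => integrable_finsetSum _ fun j _ => hi i j)]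
  refine Finset.sum_eq_zero fun i _ => ?_
  rw [integral_finsetSum _ (fun j _ => hi i j)]
  refine Finset.sum_eq_zero fun j _ => ?_
  by_cases hij : i = j
  · subst hij; simp [h0]
  rw [integral_mul_const]
  have := (hindep.indepFun hij).integral_fun_mul_eq_mul_integral (hmeas i).aestronglyMeasurable (hmeas j).aestronglyMeasurable
  rw [this, hmean i]; simp

end QR

/-- **Quadratic recursion** (Theorem 4.2). Let `x 1, …, x n` be i.i.d. real random variables
with mean `0`, variance `1` and `|x i| ≤ L` a.s., and let `{A i j}` (for `i ≠ j`) be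
deterministic matrices of a common dimension with `A i j = A j i`. For
`F(x) = ∑_{i ≠ j} (x i x j) • A i j` and every `2 ≤ t < ∞`,
`E ‖F(x) − E F(x)‖_{4t} ≤ 2 (32t)² ∑_{a+b+c=2} L^c ‖F_{a,b,c}‖_{4t}`. -/
theorem quadratic_recursion
    {Ω : Type*} [MeasurableSpace Ω] (μ : Measure Ω) [IsProbabilityMeasure μ]
    (n : ℕ) {d₁ d₂ : Type*} [Fintype d₁] [Fintype d₂] [DecidableEq d₁] [DecidableEq d₂]
    (x : Fin n → Ω → ℝ) (L : ℝ)
    (hmeas : ∀ i, Measurable (x i))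
    (hindep : iIndepFun x μ)
    (hid : ∀ i j, IdentDistrib (x i) (x j) μ μ)
    (hmean : ∀ i, ∫ ω, x i ω ∂μ = 0)
    (hvar : ∀ i, ∫ ω, (x i ω) ^ 2 ∂μ = 1)
    (hbdd : ∀ i, ∀ᵐ ω ∂μ, |x i ω| ≤ L)
    (A : Fin n → Fin n → Matrix d₁ d₂ ℝ)
    (hsymm : ∀ i j, A i j = A j i)
    (F : (Fin n → ℝ) → Matrix d₁ d₂ ℝ)
    (hF : F = fun v => ∑ i, ∑ j, if i ≠ j then (v i * v j) • A i j else 0)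
    (t : ℝ) (ht : 2 ≤ t) :
    ∫ ω, schattenNorm (2 * t)
        ((F fun i => x i ω) - matIntegral μ fun ω => F fun i => x i ω) ∂μ
      ≤ 2 * (32 * t) ^ 2 *
        ∑ a ∈ Finset.range 3, ∑ b ∈ Finset.range 3, ∑ c ∈ Finset.range 3,
          if a + b + c = 2 then L ^ c * schattenNorm (2 * t) (derivBlocks F a b c 0) else 0 := by
  set G : Fin n → Fin n → Matrix d₁ d₂ ℝ := fun i j => if i ≠ j then A i j else 0 with hGdef
  have hFG : F = QR.qf G := by
    rw [hF]; ext1 v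
    unfold QR.qf
    refine Finset.sum_congr rfl fun i _ => Finset.sum_congr rfl fun j _ => ?_
    simp only [hGdef]
    split_ifs <;> simp
  have hint : matIntegral μ (fun ω => F fun i => x i ω) = 0 := by
    rw [hFG]
    exact QR.matInt_zero μ x L hmeas hindep hmean hbdd G (fun i => by simp [hGdef])
  have hsum : (∑ a ∈ Finset.range 3, ∑ b ∈ Finset.range 3, ∑ c ∈ Finset.range 3,
          if a + b + c = 2 then L ^ c * schattenNorm (2 * t) (derivBlocks F a b c 0) else 0) = QR.rhsN G (2 * t) L := by
    rw [hFG]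
    simp [Finset.sum_range_succ, QR.rhsN]
    ring
  rw [hint, hsum]
  simp only [sub_zero]
  rw [hFG]
  rcases Nat.eq_zero_or_pos n with hn | hn
  · subst hn
    rw [QR.rhsN_zero G (2 * t) L (by linarith)]
    simp only [mul_zero]
    refine le_of_eq ?_
    have : ∀ ω, schattenNorm (2 * t) (QR.qf G fun i => x i ω) = 0 := by
      intro ω
      exact QR.sN_zero (by linarith) _ (by simp [QR.qf])
    simp [this]
  · have hg := QR.good_of μ hn x L hmeas hmean hvar hbdd
    have hm := QR.main_norm hg G (fun i j => by simp only [hGdef, hsymm i j, ne_comm]) (fun i => by simp [hGdef]) (2 * t) (by linarith)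
    have hr := QR.rhsN_nonneg G (2 * t) L (by linarith [hg.one_le])
    rw [← hindep.map_fun_eq_pi_map (fun i => (hmeas i).aemeasurable),
      integral_map (measurable_pi_lambda _ hmeas).aemeasurable (QR.cont_sN G (2 * t) (by linarith)).aestronglyMeasurable] at hm
    refine hm.trans (mul_le_mul_of_nonneg_right ?_ hr)
    nlinarith
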